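/- arXiv:math/0612445 — 3 statements merged into one kernel-verified Lean document; each statement's English description precedes it below -/
import Mathlib

section
/- Let f : ℝ → ℝ be admissible. Let (a_ε)_{ε∈(0,1]} and (b_ε)_{ε∈(0,1]} be moderate nets of smooth functions on ℝ and let (h_ε)_{ε∈(0,1]} be a moderate net of smooth functions on ℝ². Suppose that for each ε ∈ (0,1], u_ε ∈ C^∞(ℝ²) satisfies ∂_t²u_ε − ∂_x²u_ε = f(u_ε) + h_ε on ℝ², u_ε(x,0) = a_ε(x) and ∂_t u_ε(x,0) = b_ε(x) for all x ∈ ℝ. Then (u_ε)_{ε∈(0,1]} is a moderate net of smooth functions on ℝ². -/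
open Real Set Filter MeasureTheory Topology

noncomputable section

/-- An admissible nonlinearity: smooth, vanishing at 0, globally Lipschitz
(bounded first derivative), and all derivatives of at most polynomial growth. -/
def Admissible (f : ℝ → ℝ) : Prop :=
  ContDiff ℝ (⊤ : ℕ∞) f ∧ f 0 = 0 ∧ (∃ L : ℝ, ∀ y : ℝ, |deriv f y| ≤ L) ∧
  ∀ k : ℕ, ∃ C : ℝ, 0 < C ∧ ∃ N : ℕ, ∀ y : ℝ, |iteratedDeriv k f y| ≤ C * (1 + |y|) ^ N

/-- A net `(u_ε)_{ε ∈ (0,1]}` of smooth functions on `E` which is moderate: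
for every compact `K` and every derivative order `k` there is `p ≥ 0` with
`sup_K ‖D^k u_ε‖ = O(ε^{-p})` as `ε → 0`. -/
def ModerateNet {E : Type*} [NormedAddCommGroup E] [NormedSpace ℝ E]
    (u : ℝ → E → ℝ) : Prop :=
  (∀ ε ∈ Set.Ioc (0:ℝ) 1, ContDiff ℝ (⊤ : ℕ∞) (u ε)) ∧
  ∀ K : Set E, IsCompact K → ∀ k : ℕ, ∃ p : ℝ, 0 ≤ p ∧ ∃ C : ℝ, 0 < C ∧ ∃ ε₀ : ℝ, 0 < ε₀ ∧
    ∀ ε ∈ Set.Ioc (0:ℝ) 1, ε ≤ ε₀ → ∀ x ∈ K,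
      ‖iteratedFDeriv ℝ k (u ε) x‖ ≤ C * ε ^ (-p)

/-- The wave operator `∂_t² - ∂_x²` on functions of `(x,t) ∈ ℝ²`. -/
def waveOp (w : ℝ × ℝ → ℝ) (p : ℝ × ℝ) : ℝ :=
  iteratedDeriv 2 (fun s => w (p.1, s)) p.2 - iteratedDeriv 2 (fun y => w (y, p.2)) p.1

/-! ### Scales of moderate growth -/

/-- Scalar nets of at most polynomial growth in `1/ε`. -/
def ScalMod (M : ℝ → ℝ) : Prop := ∃ n : ℕ, ∀ᶠ ε in 𝓝[>] (0:ℝ), |M ε| ≤ (ε⁻¹) ^ n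

lemma ev_small {c : ℝ} (hc : 0 < c) : ∀ᶠ ε in 𝓝[>] (0:ℝ), ε ∈ Set.Ioc 0 c := Ioc_mem_nhdsGT hc

lemma ev_inv_ge (C : ℝ) : ∀ᶠ ε in 𝓝[>] (0:ℝ), C ≤ ε⁻¹ :=
  tendsto_inv_nhdsGT_zero.eventually_ge_atTop C

lemma ScalMod.mono {M N : ℝ → ℝ} (hN : ScalMod N) (h : ∀ᶠ ε in 𝓝[>] (0:ℝ), |M ε| ≤ |N ε|) :
    ScalMod M := by
  obtain ⟨n, hn⟩ := hN
  exact ⟨n, by filter_upwards [hn, h] with ε h1 h2 using h2.trans h1⟩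

lemma ScalMod.const (c : ℝ) : ScalMod (fun _ => c) :=
  ⟨1, by filter_upwards [ev_inv_ge |c|] with ε h; simpa using h⟩

lemma ScalMod.mul {M N : ℝ → ℝ} (hM : ScalMod M) (hN : ScalMod N) :
    ScalMod (fun ε => M ε * N ε) := by
  obtain ⟨m, hm⟩ := hM
  obtain ⟨n, hn⟩ := hN
  refine ⟨m + n, ?_⟩
  filter_upwards [hm, hn, ev_small one_pos] with ε h1 h2 h3
  rw [abs_mul, pow_add]
  have := h3.1
  gcongr

lemma ScalMod.add {M N : ℝ → ℝ} (hM : ScalMod M) (hN : ScalMod N) :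
    ScalMod (fun ε => M ε + N ε) := by
  obtain ⟨m, hm⟩ := hM
  obtain ⟨n, hn⟩ := hN
  refine ⟨m + n + 1, ?_⟩
  filter_upwards [hm, hn, ev_inv_ge 2, ev_inv_ge 1] with ε h1 h2 h3 h4
  have e1 : (ε⁻¹) ^ m ≤ (ε⁻¹) ^ (m + n) := pow_le_pow_right₀ h4 (by omega)
  have e2 : (ε⁻¹) ^ n ≤ (ε⁻¹) ^ (m + n) := pow_le_pow_right₀ h4 (by omega)
  have e3 : 0 ≤ (ε⁻¹) ^ (m + n) := by positivity
  calc |M ε + N ε| ≤ |M ε| + |N ε| := abs_add_le _ _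
    _ ≤ (ε⁻¹) ^ (m + n) * 2 := by linarith
    _ ≤ (ε⁻¹) ^ (m + n + 1) := by rw [pow_succ]; gcongr

lemma ScalMod.pow {M : ℝ → ℝ} (hM : ScalMod M) (k : ℕ) : ScalMod (fun ε => M ε ^ k) := by
  induction k with
  | zero => simpa using ScalMod.const 1
  | succ k ih => simpa only [pow_succ] using ih.mul hM

lemma ScalMod.sum {ι : Type*} (s : Finset ι) {M : ι → ℝ → ℝ} (hM : ∀ i ∈ s, ScalMod (M i)) :
    ScalMod (fun ε => ∑ i ∈ s, M i ε) := by
  classical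
  induction s using Finset.induction_on with
  | empty => simpa using ScalMod.const 0
  | insert a s ha ih =>
    simp only [Finset.sum_insert ha]
    exact (hM a (by simp)).add (ih fun i hi => hM i (by simp [hi]))

/-- Nets of functions which are bounded by a moderate scalar net on `s`. -/
def ModOn {X : Type*} (s : Set X) (F : ℝ → X → ℝ) : Prop :=
  ∃ M : ℝ → ℝ, ScalMod M ∧ ∀ᶠ ε in 𝓝[>] (0:ℝ), ∀ x ∈ s, |F ε x| ≤ M ε

lemma ModOn.mono {X : Type*} {s t : Set X} {F G : ℝ → X → ℝ} (hG : ModOn t G) (hst : s ⊆ t)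
    (h : ∀ᶠ ε in 𝓝[>] (0:ℝ), ∀ x ∈ s, |F ε x| ≤ |G ε x|) : ModOn s F := by
  obtain ⟨M, hM, hb⟩ := hG
  refine ⟨M, hM, ?_⟩
  filter_upwards [hb, h] with ε h1 h2 x hx using (h2 x hx).trans (h1 x (hst hx))

lemma ModOn.const {X : Type*} {s : Set X} (c : ℝ) : ModOn s (fun _ _ => c) :=
  ⟨fun _ => |c|, ScalMod.const _, by simp⟩

lemma ModOn.add {X : Type*} {s : Set X} {F G : ℝ → X → ℝ} (hF : ModOn s F) (hG : ModOn s G) :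
    ModOn s (fun ε x => F ε x + G ε x) := by
  obtain ⟨M, hM, hMb⟩ := hF
  obtain ⟨N, hN, hNb⟩ := hG
  refine ⟨_, hM.add hN, ?_⟩
  filter_upwards [hMb, hNb] with ε h1 h2 x hx
  exact (abs_add_le _ _).trans (add_le_add (h1 x hx) (h2 x hx))

lemma ModOn.mul {X : Type*} {s : Set X} {F G : ℝ → X → ℝ} (hF : ModOn s F) (hG : ModOn s G) :
    ModOn s (fun ε x => F ε x * G ε x) := by
  obtain ⟨M, hM, hMb⟩ := hF
  obtain ⟨N, hN, hNb⟩ := hG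
  refine ⟨_, hM.mul hN, ?_⟩
  filter_upwards [hMb, hNb] with ε h1 h2 x hx
  rw [abs_mul]
  exact mul_le_mul (h1 x hx) (h2 x hx) (abs_nonneg _) ((abs_nonneg _).trans (h1 x hx))

lemma ModOn.pow {X : Type*} {s : Set X} {F : ℝ → X → ℝ} (hF : ModOn s F) (k : ℕ) :
    ModOn s (fun ε x => F ε x ^ k) := by
  induction k with
  | zero => simpa using ModOn.const 1
  | succ k ih => simpa only [pow_succ] using ih.mul hF

lemma ModOn.sum {X ι : Type*} {s : Set X} (t : Finset ι) {F : ι → ℝ → X → ℝ}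
    (hF : ∀ i ∈ t, ModOn s (F i)) : ModOn s (fun ε x => ∑ i ∈ t, F i ε x) := by
  classical
  induction t using Finset.induction_on with
  | empty => simpa using ModOn.const 0
  | insert a s ha ih =>
    simp only [Finset.sum_insert ha]
    exact (hF a (by simp)).add (ih fun i hi => hF i (by simp [hi]))

/-! ### Moderateness up to a given order -/

def SmoothNet {E : Type*} [NormedAddCommGroup E] [NormedSpace ℝ E] (u : ℝ → E → ℝ) : Prop :=
  ∀ ε ∈ Set.Ioc (0:ℝ) 1, ContDiff ℝ (⊤ : ℕ∞) (u ε)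

def ModUpTo {E : Type*} [NormedAddCommGroup E] [NormedSpace ℝ E] (k : ℕ)
    (u : ℝ → E → ℝ) : Prop :=
  ∀ j ≤ k, ∀ K : Set E, IsCompact K → ModOn K (fun ε x => ‖iteratedFDeriv ℝ j (u ε) x‖)

/-- Directional derivative. -/
def dirD {E : Type*} [NormedAddCommGroup E] [NormedSpace ℝ E] (v : E) (w : E → ℝ) (p : E) : ℝ :=
  fderiv ℝ w p v

section general
variable {E : Type*} [NormedAddCommGroup E] [NormedSpace ℝ E]

lemma modUpTo_of_moderate {u : ℝ → E → ℝ} (hu : ModerateNet u) (k : ℕ) : ModUpTo k u := by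
  intro j _ K hK
  obtain ⟨p, hp, C, hC, ε₀, hε₀, hb⟩ := hu.2 K hK j
  refine ⟨fun ε => C * (ε⁻¹) ^ ⌈p⌉₊, (ScalMod.const C).mul ⟨⌈p⌉₊, ?_⟩, ?_⟩
  · filter_upwards [ev_small one_pos] with ε hε
    have := hε.1
    rw [abs_of_nonneg (by positivity)]
  · filter_upwards [ev_small one_pos, ev_small hε₀] with ε h1 h2 x hx
    rw [abs_norm]
    refine (hb ε h1 h2.2 x hx).trans ?_
    gcongr
    rw [← Real.rpow_natCast, Real.inv_rpow h1.1.le, ← Real.rpow_neg h1.1.le]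
    apply Real.rpow_le_rpow_of_exponent_ge h1.1 h1.2
    have := Nat.le_ceil p
    linarith

lemma moderate_of_modUpTo {u : ℝ → E → ℝ} (hs : SmoothNet u) (hu : ∀ k, ModUpTo k u) :
    ModerateNet u := by
  refine ⟨hs, fun K hK k => ?_⟩
  obtain ⟨M, ⟨n, hn⟩, hb⟩ := hu k k le_rfl K hK
  obtain ⟨ε₀, hε₀, h⟩ := (mem_nhdsGT_iff_exists_Ioc_subset).1 (hn.and hb)
  refine ⟨n, by positivity, 1, one_pos, ε₀, hε₀, fun ε hε hle x hx => ?_⟩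
  obtain ⟨h1, h2⟩ := h ⟨hε.1, hle⟩
  have := h2 x hx
  rw [abs_norm] at this
  rw [one_mul, Real.rpow_neg hε.1.le, Real.rpow_natCast, ← inv_pow]
  exact this.trans ((le_abs_self _).trans h1)

lemma ModUpTo.le {u : ℝ → E → ℝ} {k l : ℕ} (h : ModUpTo k u) (hl : l ≤ k) : ModUpTo l u :=
  fun j hj => h j (hj.trans hl)

lemma ModUpTo.congr {u w : ℝ → E → ℝ} {k : ℕ} (h : ModUpTo k u)
    (he : ∀ ε ∈ Set.Ioc (0:ℝ) 1, w ε = u ε) : ModUpTo k w := by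
  intro j hj K hK
  refine (h j hj K hK).mono le_rfl ?_
  filter_upwards [ev_small one_pos] with ε hε x _
  rw [he ε hε]

lemma ModUpTo.val {u : ℝ → E → ℝ} {k : ℕ} (h : ModUpTo k u) {K : Set E} (hK : IsCompact K) :
    ModOn K u := by
  refine (h 0 (by omega) K hK).mono le_rfl (Eventually.of_forall fun ε x _ => ?_)
  simp

lemma modUpTo_zero {u : ℝ → E → ℝ} (h : ∀ K : Set E, IsCompact K → ModOn K u) :
    ModUpTo 0 u := by
  intro j hj K hK
  obtain rfl : j = 0 := by omega
  refine (h K hK).mono le_rfl (Eventually.of_forall fun ε x _ => ?_)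
  simp

lemma nat_le_top' (j : ℕ) : ((j : ℕ) : WithTop ℕ∞) ≤ ((⊤ : ℕ∞) : WithTop ℕ∞) := by
  exact_mod_cast (le_top : (j : ℕ∞) ≤ ⊤)

lemma smooth_dirD {w : E → ℝ} (hw : ContDiff ℝ (⊤ : ℕ∞) w) (v : E) :
    ContDiff ℝ (⊤ : ℕ∞) (dirD v w) := by
  have : ContDiff ℝ (⊤ : ℕ∞) (fderiv ℝ w) := hw.fderiv_right (by norm_cast)
  exact this.clm_apply contDiff_const

lemma ModUpTo.add {u w : ℝ → E → ℝ} {k : ℕ} (hu : ModUpTo k u) (hw : ModUpTo k w)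
    (hus : SmoothNet u) (hws : SmoothNet w) : ModUpTo k (fun ε x => u ε x + w ε x) := by
  intro j hj K hK
  refine ((hu j hj K hK).add (hw j hj K hK)).mono le_rfl ?_
  filter_upwards [ev_small one_pos] with ε hε x _
  have := fun_iteratedFDeriv_add_apply (x := x) (((hus ε hε).of_le (nat_le_top' j)).contDiffAt)
    (((hws ε hε).of_le (nat_le_top' j)).contDiffAt)
  rw [this, abs_norm, abs_of_nonneg (by positivity)]
  exact norm_add_le _ _

lemma ModUpTo.dirD {u : ℝ → E → ℝ} {k : ℕ} (hu : ModUpTo (k+1) u) (hus : SmoothNet u) (v : E) :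
    ModUpTo k (fun ε => dirD v (u ε)) := by
  intro j hj K hK
  refine ((ModOn.const ‖v‖).mul (hu (j+1) (by omega) K hK)).mono le_rfl ?_
  filter_upwards [ev_small one_pos] with ε hε x _
  have h1 : ContDiff ℝ (⊤ : ℕ∞) (fderiv ℝ (u ε)) := (hus ε hε).fderiv_right (by norm_cast)
  have := norm_iteratedFDeriv_clm_apply_const (c := v) (x := x) h1.contDiffAt (nat_le_top' j)
  rw [norm_iteratedFDeriv_fderiv] at this
  rw [abs_norm, abs_of_nonneg (by positivity)]
  exact this

lemma ModUpTo.succ {u : ℝ → E → ℝ} {k : ℕ} (hus : SmoothNet u) (h0 : ModUpTo 0 u)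
    {v₁ v₂ : E} {l₁ l₂ : E →L[ℝ] ℝ} (hl : ∀ p : E, p = l₁ p • v₁ + l₂ p • v₂)
    (h1 : ModUpTo k (fun ε => _root_.dirD v₁ (u ε)))
    (h2 : ModUpTo k (fun ε => _root_.dirD v₂ (u ε))) :
    ModUpTo (k+1) u := by
  intro j hj K hK
  obtain _ | j := j
  · exact h0 0 le_rfl K hK
  refine (((ModOn.const ‖(ContinuousLinearMap.id ℝ ℝ).smulRight l₁‖).mul
    (h1 j (by omega) K hK)).add ((ModOn.const ‖(ContinuousLinearMap.id ℝ ℝ).smulRight l₂‖).mul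
    (h2 j (by omega) K hK))).mono le_rfl ?_
  filter_upwards [ev_small one_pos] with ε hε x _
  have e : fderiv ℝ (u ε) = (((ContinuousLinearMap.id ℝ ℝ).smulRight l₁) ∘ (_root_.dirD v₁ (u ε)))
      + (((ContinuousLinearMap.id ℝ ℝ).smulRight l₂) ∘ (_root_.dirD v₂ (u ε))) := by
    funext p
    ext q
    conv_lhs => rw [hl q]
    simp [_root_.dirD]
    ring
  have s1 := smooth_dirD (hus ε hε) v₁
  have s2 := smooth_dirD (hus ε hε) v₂
  rw [abs_norm, abs_of_nonneg (by positivity), ← norm_iteratedFDeriv_fderiv, e,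
    iteratedFDeriv_add_apply]
  · refine (norm_add_le _ _).trans (add_le_add ?_ ?_)
    · exact ContinuousLinearMap.norm_iteratedFDeriv_comp_left _ s1.contDiffAt (nat_le_top' j)
    · exact ContinuousLinearMap.norm_iteratedFDeriv_comp_left _ s2.contDiffAt (nat_le_top' j)
  · exact ((ContinuousLinearMap.contDiff _).comp (s1.of_le (nat_le_top' j))).contDiffAt
  · exact ((ContinuousLinearMap.contDiff _).comp (s2.of_le (nat_le_top' j))).contDiffAt

lemma ModUpTo.comp {f : ℝ → ℝ} (hf : Admissible f) {u : ℝ → E → ℝ} {k : ℕ} (hus : SmoothNet u)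
    (hu : ModUpTo k u) : ModUpTo k (fun ε x => f (u ε x)) := by
  intro j hj K hK
  have hC : ModOn K (fun ε x => ∑ i ∈ Finset.range (j+1), |iteratedDeriv i f (u ε x)|) := by
    refine ModOn.sum _ fun i _ => ?_
    obtain ⟨C, hC, N, hN⟩ := hf.2.2.2 i
    have a1 : ModOn K (fun ε x => ‖iteratedFDeriv ℝ 0 (u ε) x‖) := hu 0 (by omega) K hK
    refine ((ModOn.const C).mul (((ModOn.const 1).add a1).pow N)).mono le_rfl
      (Eventually.of_forall fun ε x _ => ?_)
    rw [abs_abs]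
    refine le_trans ?_ (le_abs_self _)
    rw [norm_iteratedFDeriv_zero, Real.norm_eq_abs]
    exact hN (u ε x)
  have hD : ModOn K (fun ε x => 1 + ∑ i ∈ Finset.range (j+1), ‖iteratedFDeriv ℝ i (u ε) x‖) := by
    refine (ModOn.const 1).add (ModOn.sum _ fun i hi => hu i ?_ K hK)
    simp at hi
    omega
  refine (((ModOn.const (j.factorial : ℝ)).mul hC).mul (hD.pow j)).mono le_rfl ?_
  filter_upwards [ev_small one_pos] with ε hε x _
  rw [abs_norm, abs_of_nonneg (by positivity)]
  refine norm_iteratedFDeriv_comp_le hf.1 (hus ε hε) (nat_le_top' j) x ?_ ?_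
  · intro i hi
    rw [norm_iteratedFDeriv_eq_norm_iteratedDeriv, Real.norm_eq_abs]
    exact Finset.single_le_sum (f := fun i => |iteratedDeriv i f (u ε x)|)
      (fun _ _ => abs_nonneg _) (by simp; omega)
  · intro i hi1 hi
    have h1 : ‖iteratedFDeriv ℝ i (u ε) x‖ ≤
        ∑ i ∈ Finset.range (j+1), ‖iteratedFDeriv ℝ i (u ε) x‖ :=
      Finset.single_le_sum (f := fun i => ‖iteratedFDeriv ℝ i (u ε) x‖)
        (fun _ _ => norm_nonneg _) (by simp; omega)
    have h2 : 0 ≤ ∑ i ∈ Finset.range (j+1), ‖iteratedFDeriv ℝ i (u ε) x‖ := by positivity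
    refine le_trans (by linarith) (le_self_pow₀ (by linarith) (by omega : i ≠ 0))

lemma dirD_comm {w : E → ℝ} (hw : ContDiff ℝ (⊤ : ℕ∞) w) (v v' : E) (p : E) :
    dirD v (dirD v' w) p = fderiv ℝ (fderiv ℝ w) p v v' ∧
    fderiv ℝ (fderiv ℝ w) p v v' = fderiv ℝ (fderiv ℝ w) p v' v := by
  have h1 : ContDiff ℝ (⊤ : ℕ∞) (fderiv ℝ w) := hw.fderiv_right (by norm_cast)
  have h2 : DifferentiableAt ℝ (fderiv ℝ w) p := (h1.differentiable (by simp)) p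
  constructor
  · have := (h2.hasFDerivAt.clm_apply (hasFDerivAt_const v' p)).fderiv
    unfold dirD
    rw [this]
    simp
  · exact (hw.contDiffAt.isSymmSndFDerivAt (by simpa using nat_le_top' 2)) v v'

end general

/-! ### Cones, transport and the a priori estimate -/

def cone (R : ℝ) : Set (ℝ × ℝ) := {p | |p.1| + |p.2| ≤ R}

lemma isCompact_cone (R : ℝ) : IsCompact (cone R) := by
  refine (isCompact_closedBall (0 : ℝ × ℝ) R).of_isClosed_subset ?_ ?_
  · exact isClosed_le (by fun_prop) continuous_const
  · intro p hp
    have hp' : |p.1| + |p.2| ≤ R := hp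
    have h1 := abs_nonneg p.1
    have h2 := abs_nonneg p.2
    rw [mem_closedBall_zero_iff, Prod.norm_def, Real.norm_eq_abs, Real.norm_eq_abs]
    exact max_le (by linarith) (by linarith)

lemma subset_cone {K : Set (ℝ × ℝ)} (hK : IsCompact K) : ∃ R, 0 ≤ R ∧ K ⊆ cone R := by
  obtain ⟨r, hr⟩ := hK.isBounded.subset_closedBall (0 : ℝ × ℝ)
  refine ⟨2 * |r|, by positivity, fun p hp => ?_⟩
  have h := hr hp
  rw [mem_closedBall_zero_iff, Prod.norm_def, Real.norm_eq_abs, Real.norm_eq_abs] at h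
  have h1 := (le_max_left _ _).trans h
  have h2 := (le_max_right _ _).trans h
  have h3 := le_abs_self r
  show |p.1| + |p.2| ≤ 2 * |r|
  linarith

lemma transport_aux {w : ℝ × ℝ → ℝ} (hw : Differentiable ℝ w) {c : ℝ} (hc : |c| ≤ 1) {R : ℝ}
    {β β' : ℝ → ℝ} (hβ : ∀ s, HasDerivAt β (β' s) s)
    (h0 : ∀ y, |y| ≤ R → |w (y, 0)| ≤ β 0)
    (h1 : ∀ p ∈ cone R, |dirD (c, 1) w p| ≤ β' |p.2|)
    {p : ℝ × ℝ} (hp : p ∈ cone R) : |w p| ≤ β |p.2| := by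
  obtain ⟨x, t⟩ := p
  have hp' : |x| + |t| ≤ R := hp
  obtain ⟨σ, hσ, hσt⟩ : ∃ σ : ℝ, |σ| = 1 ∧ σ * |t| = t := by
    rcases le_total 0 t with h | h
    · exact ⟨1, by simp, by rw [abs_of_nonneg h]; ring⟩
    · exact ⟨-1, by simp, by rw [abs_of_nonpos h]; ring⟩
  have hcone : ∀ s ∈ Set.Icc 0 |t|, ((x - c * (t - σ * s), σ * s) : ℝ × ℝ) ∈ cone R := by
    intro s hs
    show |x - c * (t - σ * s)| + |σ * s| ≤ R
    have e1 : |σ * s| = s := by rw [abs_mul, hσ, one_mul, abs_of_nonneg hs.1]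
    have e2 : |t - σ * s| = |t| - s := by
      conv_lhs => rw [← hσt]
      rw [← mul_sub, abs_mul, hσ, one_mul, abs_of_nonneg (by linarith [hs.2])]
    have e3 : |c * (t - σ * s)| ≤ |t| - s := by
      rw [abs_mul, e2]
      nlinarith [hs.2]
    have e4 := abs_sub x (c * (t - σ * s))
    linarith
  have hd : ∀ s : ℝ, HasDerivAt (fun s => w (x - c * (t - σ * s), σ * s))
      (σ * dirD (c, 1) w (x - c * (t - σ * s), σ * s)) s := by
    intro s
    have g1 : HasDerivAt (fun s : ℝ => x - c * (t - σ * s)) (c * σ) s := by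
      have := ((((hasDerivAt_id s).const_mul σ).const_sub t).const_mul c).const_sub x
      exact this.congr_deriv (by simp)
    have g2 : HasDerivAt (fun s : ℝ => σ * s) σ s := by
      simpa using (hasDerivAt_id s).const_mul σ
    have g3 := (hw (x - c * (t - σ * s), σ * s)).hasFDerivAt.comp_hasDerivAt s (g1.prodMk g2)
    refine g3.congr_deriv ?_
    have : ((c * σ, σ) : ℝ × ℝ) = σ • ((c, 1) : ℝ × ℝ) := by ext <;> simp [mul_comm]
    rw [this, map_smul]
    rfl
  have key := image_norm_le_of_norm_deriv_right_le_deriv_boundary (a := 0) (b := |t|)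
    (f := fun s => w (x - c * (t - σ * s), σ * s))
    (f' := fun s => σ * dirD (c, 1) w (x - c * (t - σ * s), σ * s)) (B := β) (B' := β')
    (fun s _ => (hd s).continuousAt.continuousWithinAt)
    (fun s _ => (hd s).hasDerivWithinAt) ?_ hβ ?_ (x := |t|) ⟨abs_nonneg _, le_rfl⟩
  · simp only [hσt, sub_self, mul_zero, sub_zero, Real.norm_eq_abs] at key
    exact key
  · have h00 := hcone 0 ⟨le_rfl, abs_nonneg _⟩
    simp only [mul_zero] at h00 ⊢
    rw [Real.norm_eq_abs]
    apply h0
    have : |x - c * (t - 0)| + |(0:ℝ)| ≤ R := h00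
    simpa using this
  · intro s hs
    rw [Real.norm_eq_abs, abs_mul, hσ, one_mul]
    have := h1 _ (hcone s ⟨hs.1, hs.2.le⟩)
    simp only [abs_mul, hσ, one_mul, abs_of_nonneg hs.1] at this
    exact this

lemma apriori {u : ℝ × ℝ → ℝ} (hu : ContDiff ℝ (⊤ : ℕ∞) u) {L A B R : ℝ} (hL : 0 ≤ L)
    (hA : 0 ≤ A) (hB : 0 ≤ B) (hR : 0 ≤ R)
    (hp1 : ∀ p ∈ cone R, |dirD (-1, 1) (dirD (1, 1) u) p| ≤ L * |u p| + B)
    (hp2 : ∀ p ∈ cone R, |dirD (1, 1) (dirD (-1, 1) u) p| ≤ L * |u p| + B)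
    (h0 : ∀ y, |y| ≤ R → |u (y, 0)| ≤ A)
    (h1 : ∀ y, |y| ≤ R → |dirD (1, 1) u (y, 0)| ≤ A)
    (h2 : ∀ y, |y| ≤ R → |dirD (-1, 1) u (y, 0)| ≤ A) {p : ℝ × ℝ} (hp : p ∈ cone R) :
    |u p| ≤ 2 * (A + A * R + B * R ^ 2) * Real.exp ((2 * L + 1) * R) := by
  set lam := 2 * L + 1 with hlam
  have hlam0 : 0 < lam := by positivity
  obtain ⟨q, hq, hmax⟩ := (isCompact_cone R).exists_isMaxOn ⟨p, hp⟩
    (f := fun p : ℝ × ℝ => Real.exp (-(lam * |p.2|)) * |u p|)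
    (by have := hu.continuous; fun_prop)
  set N := Real.exp (-(lam * |q.2|)) * |u q| with hN
  have hN0 : 0 ≤ N := by positivity
  have hNb : ∀ p ∈ cone R, |u p| ≤ N * Real.exp (lam * |p.2|) := by
    intro p hp
    have h : Real.exp (-(lam * |p.2|)) * |u p| ≤ N := hmax hp
    calc |u p| = (Real.exp (-(lam * |p.2|)) * |u p|) * Real.exp (lam * |p.2|) := by
          rw [mul_right_comm, ← Real.exp_add]; simp
      _ ≤ _ := by gcongr
  have hexp : ∀ s : ℝ, HasDerivAt (fun s => Real.exp (lam * s)) (lam * Real.exp (lam * s)) s := by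
    intro s
    have := ((hasDerivAt_id s).const_mul lam).exp
    exact this.congr_deriv (by simp [mul_comm])
  have hβ1 : ∀ s : ℝ, HasDerivAt (fun s => A + B * s + L * N / lam * Real.exp (lam * s))
      (B + L * N * Real.exp (lam * s)) s := by
    intro s
    have := (((hasDerivAt_id s).const_mul B).const_add A).add ((hexp s).const_mul (L * N / lam))
    exact this.congr_deriv (by field_simp)
  have hβ0 : ∀ s : ℝ, HasDerivAt
      (fun s => A + A * s + B * s ^ 2 / 2 + L * N / lam ^ 2 * Real.exp (lam * s))
      (A + B * s + L * N / lam * Real.exp (lam * s)) s := by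
    intro s
    have := ((((hasDerivAt_id s).const_mul A).const_add A).add
      ((((hasDerivAt_id s).pow 2).const_mul B).div_const 2)).add
      ((hexp s).const_mul (L * N / lam ^ 2))
    exact this.congr_deriv (by simp; field_simp)
  have hs : ∀ p ∈ cone R, L * |u p| + B ≤ B + L * N * Real.exp (lam * |p.2|) := by
    intro p hp
    have := mul_le_mul_of_nonneg_left (hNb p hp) hL
    linarith
  have hstart : A ≤ A + B * 0 + L * N / lam * Real.exp (lam * 0) := by
    have : 0 ≤ L * N / lam * Real.exp (lam * 0) := by positivity
    linarith
  have k1 : ∀ p ∈ cone R, |dirD (1, 1) u p| ≤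
      A + B * |p.2| + L * N / lam * Real.exp (lam * |p.2|) := fun p hp =>
    transport_aux ((smooth_dirD hu _).differentiable (by simp)) (c := -1) (by simp) hβ1
      (fun y hy => (h1 y hy).trans hstart) (fun p hp => (hp1 p hp).trans (hs p hp)) hp
  have k2 : ∀ p ∈ cone R, |dirD (-1, 1) u p| ≤
      A + B * |p.2| + L * N / lam * Real.exp (lam * |p.2|) := fun p hp =>
    transport_aux ((smooth_dirD hu _).differentiable (by simp)) (c := 1) (by simp) hβ1
      (fun y hy => (h2 y hy).trans hstart) (fun p hp => (hp2 p hp).trans (hs p hp)) hp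
  have k0 : ∀ p ∈ cone R, |u p| ≤
      A + A * |p.2| + B * |p.2| ^ 2 / 2 + L * N / lam ^ 2 * Real.exp (lam * |p.2|) := by
    intro p hp
    refine transport_aux (hu.differentiable (by simp)) (c := 0) (by simp) hβ0
      (fun y hy => (h0 y hy).trans ?_) (fun p hp => ?_) hp
    · have : 0 ≤ L * N / lam ^ 2 * Real.exp (lam * 0) := by positivity
      linarith
    · have e : dirD (0, 1) u p = (dirD (1, 1) u p + dirD (-1, 1) u p) / 2 := by
        unfold dirD
        rw [← map_add]
        have : ((1, 1) + (-1, 1) : ℝ × ℝ) = (2:ℝ) • ((0, 1) : ℝ × ℝ) := by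
          ext <;> norm_num
        rw [this, map_smul]
        simp
      rw [e, abs_div, abs_two]
      have := abs_add_le (dirD (1, 1) u p) (dirD (-1, 1) u p)
      have := k1 p hp
      have := k2 p hp
      linarith
  have hcone2 : ∀ p ∈ cone R, |p.2| ≤ R := fun p hp => by
    have hp' : |p.1| + |p.2| ≤ R := hp
    linarith [abs_nonneg p.1]
  have hNle : N ≤ 2 * (A + A * R + B * R ^ 2) := by
    have e1 := k0 q hq
    have e2 := hcone2 q hq
    have e3 : L * N / lam ^ 2 ≤ N / 2 := by
      rw [div_le_div_iff₀ (by positivity) two_pos]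
      have : 2 * L ≤ lam ^ 2 := by rw [hlam]; nlinarith
      nlinarith
    have e4 : A + A * |q.2| + B * |q.2| ^ 2 / 2 ≤ A + A * R + B * R ^ 2 := by
      have : B * |q.2| ^ 2 ≤ B * R ^ 2 := by gcongr
      have : A * |q.2| ≤ A * R := by gcongr
      have : 0 ≤ B * |q.2| ^ 2 := by positivity
      linarith
    have e5 : Real.exp (-(lam * |q.2|)) ≤ 1 := by
      rw [Real.exp_le_one_iff]
      have : 0 ≤ lam * |q.2| := by positivity
      linarith
    have e6 : 0 ≤ A + A * R + B * R ^ 2 := by positivity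
    have e7 : Real.exp (-(lam * |q.2|)) * Real.exp (lam * |q.2|) = 1 := by
      rw [← Real.exp_add]; simp
    have e8 : N ≤ (A + A * R + B * R ^ 2) + N / 2 := by
      calc N ≤ Real.exp (-(lam * |q.2|)) *
            ((A + A * R + B * R ^ 2) + L * N / lam ^ 2 * Real.exp (lam * |q.2|)) := by
            rw [hN]; gcongr; linarith
        _ = Real.exp (-(lam * |q.2|)) * (A + A * R + B * R ^ 2) + L * N / lam ^ 2 := by
            linear_combination (L * N / lam ^ 2) * e7
        _ ≤ 1 * (A + A * R + B * R ^ 2) + N / 2 := by gcongr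
        _ = _ := by ring
    linarith
  refine (hNb p hp).trans ?_
  have := hcone2 p hp
  gcongr

/-! ### Transport lemma for nets -/

lemma dirD_slice1 {w : ℝ × ℝ → ℝ} (hw : Differentiable ℝ w) (y t : ℝ) :
    HasDerivAt (fun y => w (y, t)) (dirD (1, 0) w (y, t)) y :=
  (hw (y, t)).hasFDerivAt.comp_hasDerivAt y ((hasDerivAt_id y).prodMk (hasDerivAt_const y t))

lemma dirD_slice2 {w : ℝ × ℝ → ℝ} (hw : Differentiable ℝ w) (y t : ℝ) :
    HasDerivAt (fun t => w (y, t)) (dirD (0, 1) w (y, t)) t :=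
  (hw (y, t)).hasFDerivAt.comp_hasDerivAt t ((hasDerivAt_const t y).prodMk (hasDerivAt_id t))

lemma smooth_slice {w : ℝ × ℝ → ℝ} (hw : ContDiff ℝ (⊤ : ℕ∞) w) :
    ContDiff ℝ (⊤ : ℕ∞) (fun y : ℝ => w (y, 0)) :=
  hw.comp (contDiff_id.prodMk contDiff_const)

lemma transport_zero {w : ℝ → ℝ × ℝ → ℝ} (hw : SmoothNet w) {c : ℝ} (hc : |c| ≤ 1)
    (h1 : ModUpTo 0 (fun ε => dirD (c, 1) (w ε)))
    (h0 : ModUpTo 0 (fun ε (y : ℝ) => w ε (y, 0))) : ModUpTo 0 w := by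
  refine modUpTo_zero fun K hK => ?_
  obtain ⟨R, hR, hKR⟩ := subset_cone hK
  obtain ⟨M, hM, hMb⟩ := h1.val (isCompact_cone R)
  obtain ⟨A, hA, hAb⟩ := h0.val (isCompact_Icc (a := -R) (b := R))
  refine ⟨fun ε => A ε + M ε * R, hA.add (hM.mul (ScalMod.const R)), ?_⟩
  filter_upwards [hMb, hAb, ev_small one_pos] with ε e1 e2 e3 p hp
  have hM0 : 0 ≤ M ε := (abs_nonneg _).trans (e1 p (hKR hp))
  refine (transport_aux ((hw ε e3).differentiable (by simp)) hc
    (β := fun s => A ε + M ε * s) (β' := fun _ => M ε) (fun s => ?_) (fun y hy => ?_) e1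
    (hKR hp)).trans ?_
  · simpa using ((hasDerivAt_id s).const_mul (M ε)).const_add (A ε)
  · simpa using e2 y (abs_le.1 hy)
  · have hp' : |p.1| + |p.2| ≤ R := hKR hp
    have : |p.2| ≤ R := by linarith [abs_nonneg p.1]
    show A ε + M ε * |p.2| ≤ _
    gcongr

lemma transport {c : ℝ} (hc : |c| ≤ 1) (k : ℕ) : ∀ {w : ℝ → ℝ × ℝ → ℝ}, SmoothNet w →
    ModUpTo k (fun ε => dirD (c, 1) (w ε)) →
    ModUpTo k (fun ε (y : ℝ) => w ε (y, 0)) → ModUpTo k w := by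
  induction k with
  | zero => exact fun hw h1 h0 => transport_zero hw hc h1 h0
  | succ k ih =>
    intro w hw h1 h0
    have hz := transport_zero hw hc (h1.le (by omega)) (h0.le (by omega))
    refine ModUpTo.succ hw hz (v₁ := (1, 0)) (v₂ := (c, 1))
      (l₁ := ContinuousLinearMap.fst ℝ ℝ ℝ - c • ContinuousLinearMap.snd ℝ ℝ ℝ)
      (l₂ := ContinuousLinearMap.snd ℝ ℝ ℝ) ?_ ?_ (h1.le (by omega))
    · intro p
      ext <;> simp
      ring
    · refine ih (fun ε hε => smooth_dirD (hw ε hε) _) ?_ ?_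
      · refine (h1.dirD (fun ε hε => smooth_dirD (hw ε hε) _) (1, 0)).congr fun ε hε => ?_
        funext p
        obtain ⟨a1, a2⟩ := dirD_comm (hw ε hε) (c, 1) (1, 0) p
        rw [a1, a2, (dirD_comm (hw ε hε) (1, 0) (c, 1) p).1]
      · refine (h0.dirD (fun ε hε => smooth_slice (hw ε hε)) (1:ℝ)).congr fun ε hε => ?_
        funext y
        have := dirD_slice1 ((hw ε hε).differentiable (by simp)) y 0
        show _ = fderiv ℝ _ y 1
        rw [fderiv_apply_one_eq_deriv, this.deriv]

lemma waveOp_eq {w : ℝ × ℝ → ℝ} (hw : ContDiff ℝ (⊤ : ℕ∞) w) (p : ℝ × ℝ) :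
    dirD (-1, 1) (dirD (1, 1) w) p = waveOp w p ∧
    dirD (1, 1) (dirD (-1, 1) w) p = waveOp w p := by
  have d0 := hw.differentiable (by simp)
  have e1 : iteratedDeriv 2 (fun s => w (p.1, s)) p.2 = dirD (0, 1) (dirD (0, 1) w) p := by
    rw [iteratedDeriv_succ, iteratedDeriv_one]
    have : deriv (fun s => w (p.1, s)) = fun s => dirD (0, 1) w (p.1, s) :=
      funext fun s => (dirD_slice2 d0 p.1 s).deriv
    rw [this]
    exact (dirD_slice2 ((smooth_dirD hw _).differentiable (by simp)) p.1 p.2).deriv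
  have e2 : iteratedDeriv 2 (fun y => w (y, p.2)) p.1 = dirD (1, 0) (dirD (1, 0) w) p := by
    rw [iteratedDeriv_succ, iteratedDeriv_one]
    have : deriv (fun y => w (y, p.2)) = fun y => dirD (1, 0) w (y, p.2) :=
      funext fun s => (dirD_slice1 d0 s p.2).deriv
    rw [this]
    exact (dirD_slice1 ((smooth_dirD hw _).differentiable (by simp)) p.1 p.2).deriv
  have v1 : ((1, 1) : ℝ × ℝ) = (1, 0) + (0, 1) := by simp
  have v2 : ((-1, 1) : ℝ × ℝ) = -(1, 0) + (0, 1) := by simp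
  have c0 := (dirD_comm hw (1, 0) (0, 1) p).2
  unfold waveOp
  rw [e1, e2, (dirD_comm hw _ _ p).1, (dirD_comm hw _ _ p).1, (dirD_comm hw _ _ p).1,
    (dirD_comm hw _ _ p).1, v1, v2]
  simp only [map_add, map_neg, add_apply, neg_apply]
  rw [c0]
  constructor <;> ring

/-- Existence part of Colombeau solvability: a net of classical solutions of the
semilinear wave equation with moderate data is moderate. -/
theorem semilinear_wave_moderate
    (f : ℝ → ℝ) (hf : Admissible f)
    (a b : ℝ → ℝ → ℝ) (h u : ℝ → ℝ × ℝ → ℝ)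
    (ha : ModerateNet a) (hb : ModerateNet b) (hh : ModerateNet h)
    (husmooth : ∀ ε ∈ Set.Ioc (0:ℝ) 1, ContDiff ℝ (⊤ : ℕ∞) (u ε))
    (hpde : ∀ ε ∈ Set.Ioc (0:ℝ) 1, ∀ p : ℝ × ℝ, waveOp (u ε) p = f (u ε p) + h ε p)
    (hinit0 : ∀ ε ∈ Set.Ioc (0:ℝ) 1, ∀ x : ℝ, u ε (x, 0) = a ε x)
    (hinit1 : ∀ ε ∈ Set.Ioc (0:ℝ) 1, ∀ x : ℝ, deriv (fun s => u ε (x, s)) 0 = b ε x) :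
    ModerateNet u := by
  have hus : SmoothNet u := husmooth
  -- the right-hand side
  set g : ℝ → ℝ × ℝ → ℝ := fun ε p => f (u ε p) + h ε p with hg
  have hgk : ∀ k, ModUpTo k u → ModUpTo k g := fun k hk =>
    (hk.comp hf hus).add (modUpTo_of_moderate hh k)
      (fun ε hε => hf.1.comp (husmooth ε hε)) hh.1
  -- the initial data of the first derivatives
  have hx0 : ∀ ε ∈ Set.Ioc (0:ℝ) 1, ∀ y, dirD (1, 0) (u ε) (y, 0) = dirD (1:ℝ) (a ε) y := by
    intro ε hε y
    have h1 := dirD_slice1 ((hus ε hε).differentiable (by simp)) y 0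
    have : (fun y => u ε (y, 0)) = a ε := funext (hinit0 ε hε)
    rw [this] at h1
    show _ = fderiv ℝ _ y 1
    rw [fderiv_apply_one_eq_deriv, h1.deriv]
  have ht0 : ∀ ε ∈ Set.Ioc (0:ℝ) 1, ∀ y, dirD (0, 1) (u ε) (y, 0) = b ε y := by
    intro ε hε y
    rw [← hinit1 ε hε y]
    exact (dirD_slice2 ((hus ε hε).differentiable (by simp)) y 0).deriv.symm
  have hdata : ∀ (c : ℝ) (k : ℕ), ModUpTo k (fun ε (y : ℝ) => dirD (c, 1) (u ε) (y, 0)) := by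
    intro c k
    have m1 : ModUpTo k (fun ε => dirD (c : ℝ) (a ε)) :=
      (modUpTo_of_moderate ha (k+1)).dirD ha.1 c
    refine (m1.add (modUpTo_of_moderate hb k)
      (fun ε hε => smooth_dirD (ha.1 ε hε) _) hb.1).congr fun ε hε => ?_
    funext y
    rw [← ht0 ε hε y]
    have e1 : dirD (c : ℝ) (a ε) y = c * dirD (1:ℝ) (a ε) y := by
      unfold dirD
      rw [← smul_eq_mul, ← map_smul]
      simp
    rw [e1, ← hx0 ε hε y]
    unfold dirD
    rw [← smul_eq_mul, ← map_smul, ← map_add]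
    simp
  have hw1 : ∀ ε ∈ Set.Ioc (0:ℝ) 1, dirD (-1, 1) (dirD (1, 1) (u ε)) = g ε := fun ε hε =>
    funext fun p => by rw [(waveOp_eq (hus ε hε) p).1, hpde ε hε p]
  have hw2 : ∀ ε ∈ Set.Ioc (0:ℝ) 1, dirD (1, 1) (dirD (-1, 1) (u ε)) = g ε := fun ε hε =>
    funext fun p => by rw [(waveOp_eq (hus ε hε) p).2, hpde ε hε p]
  -- order zero
  have hM0 : ModUpTo 0 u := by
    obtain ⟨L, hL⟩ := hf.2.2.1
    have hL0 : 0 ≤ L := (abs_nonneg _).trans (hL 0)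
    have hfL : ∀ y, |f y| ≤ L * |y| := by
      intro y
      have := Convex.norm_image_sub_le_of_norm_deriv_le (f := f) (s := Set.univ) (x := 0) (y := y)
        (fun x _ => (hf.1.differentiable (by simp)) x) (fun x _ => hL x) convex_univ
        (Set.mem_univ _) (Set.mem_univ _)
      simpa [hf.2.1] using this
    refine modUpTo_zero fun K hK => ?_
    obtain ⟨R, hR, hKR⟩ := subset_cone hK
    obtain ⟨B, hB, hBb⟩ := (modUpTo_of_moderate hh 0).val (isCompact_cone R)
    obtain ⟨A0, hA0, hA0b⟩ := (modUpTo_of_moderate ha 0).val (isCompact_Icc (a := -R) (b := R))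
    obtain ⟨A1, hA1, hA1b⟩ := (hdata 1 0).val (isCompact_Icc (a := -R) (b := R))
    obtain ⟨A2, hA2, hA2b⟩ := (hdata (-1) 0).val (isCompact_Icc (a := -R) (b := R))
    have hA := (hA0.add hA1).add hA2
    refine ⟨fun ε => 2 * ((A0 ε + A1 ε + A2 ε) + (A0 ε + A1 ε + A2 ε) * R + B ε * R ^ 2) *
      Real.exp ((2 * L + 1) * R), ((ScalMod.const 2).mul ((hA.add (hA.mul (ScalMod.const R))).add
        (hB.mul (ScalMod.const (R ^ 2))))).mul (ScalMod.const _), ?_⟩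
    filter_upwards [hBb, hA0b, hA1b, hA2b, ev_small one_pos] with ε b0 b1 b2 b3 hε p hp
    have z : (0:ℝ) ∈ Set.Icc (-R) R := ⟨by linarith, hR⟩
    have n0 := (abs_nonneg _).trans (b1 0 z)
    have n1 := (abs_nonneg _).trans (b2 0 z)
    have n2 := (abs_nonneg _).trans (b3 0 z)
    have nB := (abs_nonneg _).trans (b0 p (hKR hp))
    have hgb : ∀ p ∈ cone R, |g ε p| ≤ L * |u ε p| + B ε := fun p hp =>
      (abs_add_le _ _).trans (add_le_add (hfL _) (b0 p hp))
    refine apriori (hus ε hε) hL0 (by positivity) nB hR ?_ ?_ ?_ ?_ ?_ (hKR hp)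
    · rw [hw1 ε hε]; exact hgb
    · rw [hw2 ε hε]; exact hgb
    · intro y hy
      rw [hinit0 ε hε y]
      linarith [b1 y (abs_le.1 hy)]
    · intro y hy
      linarith [b2 y (abs_le.1 hy)]
    · intro y hy
      linarith [b3 y (abs_le.1 hy)]
  refine moderate_of_modUpTo hus fun k => ?_
  induction k with
  | zero => exact hM0
  | succ k ih =>
    refine ModUpTo.succ hus hM0 (v₁ := (1, 1)) (v₂ := (-1, 1))
      (l₁ := (1/2 : ℝ) • (ContinuousLinearMap.snd ℝ ℝ ℝ + ContinuousLinearMap.fst ℝ ℝ ℝ))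
      (l₂ := (1/2 : ℝ) • (ContinuousLinearMap.snd ℝ ℝ ℝ - ContinuousLinearMap.fst ℝ ℝ ℝ)) ?_ ?_ ?_
    · intro p
      ext <;> simp <;> ring
    · exact transport (c := -1) (by simp) k (fun ε hε => smooth_dirD (hus ε hε) _)
        ((hgk k ih).congr hw1) (hdata 1 k)
    · exact transport (c := 1) (by simp) k (fun ε hε => smooth_dirD (hus ε hε) _)
        ((hgk k ih).congr hw2) (hdata (-1) k)
end
end

section
/- Let f : ℝ → ℝ be admissible and globally bounded. Let φ ∈ S(ℝ) with ∫φ(x)dx = 1 and ∫x^k φ(x)dx = 0 for all integers k ≥ 1, and set φ_ε(x) = ε^{−1}φ(x/ε). Fix distinct points x_1 < … < x_J in ℝ, an integer m ≥ 0, and real coefficients c_{j,α}, d_{j,α} for 1 ≤ j ≤ J, 0 ≤ α ≤ m. Define a_ε(x) = Σ_{j,α} c_{j,α} φ_ε^{(α)}(x − x_j) and b_ε(x) = Σ_{j,α} d_{j,α} φ_ε^{(α)}(x − x_j), and let v_ε(x,t) = ½(a_ε(x−t) + a_ε(x+t)) + ½∫_{x−t}^{x+t} b_ε(y)dy. Let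 P : ℝ×[0,∞) → ℝ be P(x,t) = ½ Σ_j d_{j,0} 𝟙_{|x−x_j| < t}, and let w ∈ C(ℝ×[0,∞)) satisfy the integral equation w(x,t) = ½∫_0^t∫_{x−t+s}^{x+t−s} f(P(y,s) + w(y,s)) dy ds for all x ∈ ℝ, t ≥ 0. For each ε let u_ε ∈ C^∞(ℝ²) solve ∂_t²u_ε − ∂_x²u_ε = f(u_ε) with u_ε(·,0) = a_ε, ∂_t u_ε(·,0) = b_ε. Then for every κ > 0 and 0 ≤ T ≤ κ, the integral ∫_{K_T} |u_ε(x,t) − v_ε(x,t) − w(x,t)| dx dt tends to 0 as ε → 0. -/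
open Real Set Filter MeasureTheory Topology

noncomputable section

/-- The trapezoidal domain of dependence `K_T` over the base `[-κ,κ]`. -/
def KT (κ T : ℝ) : Set (ℝ × ℝ) :=
  {p : ℝ × ℝ | 0 ≤ p.2 ∧ p.2 ≤ T ∧ |p.1| ≤ κ - p.2}

lemma dw_prim_deriv (q q' : ℝ → ℝ → ℝ) (hq : Continuous fun p : ℝ × ℝ => q p.1 p.2)
    (hq' : Continuous fun p : ℝ × ℝ => q' p.1 p.2)
    (hd : ∀ y s, HasDerivAt (fun s => q y s) (q' y s) s) (l : ℝ → ℝ) (l' s : ℝ)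
    (hl : HasDerivAt l l' s) :
    HasDerivAt (fun s => ∫ y in (0:ℝ)..l s, q y s)
      (q (l s) s * l' + ∫ y in (0:ℝ)..l s, q' y s) s := by
  have key : HasStrictFDerivAt (fun p : ℝ × ℝ => ∫ y in (0:ℝ)..p.1, q y p.2)
      ((ContinuousLinearMap.toSpanSingleton ℝ (q (l s) s)).coprod
        (ContinuousLinearMap.toSpanSingleton ℝ (∫ y in (0:ℝ)..l s, q' y s))) (l s, s) := by
    refine hasStrictFDerivAt_uncurry_coprod (u := (l s, s))
      (f := fun x s => ∫ y in (0:ℝ)..x, q y s)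
      (f₁ := fun x s => ContinuousLinearMap.toSpanSingleton ℝ (q x s))
      (f₂ := fun x s => ContinuousLinearMap.toSpanSingleton ℝ (∫ y in (0:ℝ)..x, q' y s))
      (Eventually.of_forall ?_) (Eventually.of_forall ?_) ?_ ?_
    · intro p
      have hc : Continuous fun y => q y p.2 := hq.comp (by fun_prop : Continuous fun y => (y, p.2))
      exact (intervalIntegral.integral_hasDerivAt_right (hc.intervalIntegrable _ _)
        (hc.stronglyMeasurableAtFilter _ _) hc.continuousAt).hasFDerivAt
    · intro p
      have hK : IsCompact ((uIcc 0 p.1) ×ˢ (Icc (p.2 - 1) (p.2 + 1))) :=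
        isCompact_uIcc.prod isCompact_Icc
      obtain ⟨M, hM⟩ := hK.exists_bound_of_continuousOn hq'.continuousOn
      have := (intervalIntegral.hasDerivAt_integral_of_dominated_loc_of_deriv_le
        (μ := volume) (a := 0) (b := p.1) (x₀ := p.2)
        (F := fun s y => q y s) (F' := fun s y => q' y s) (bound := fun _ => M)
        (s := Icc (p.2 - 1) (p.2 + 1)) (Icc_mem_nhds (by linarith) (by linarith)) ?_ ?_ ?_ ?_ ?_ ?_).2
      · exact this.hasFDerivAt
      · refine Eventually.of_forall fun x => Continuous.aestronglyMeasurable ?_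
        exact hq.comp (by fun_prop : Continuous fun y => (y, x))
      · exact (hq.comp (by fun_prop : Continuous fun y => (y, p.2))).intervalIntegrable _ _
      · exact (hq'.comp (by fun_prop : Continuous fun y => (y, p.2))).aestronglyMeasurable
      · refine Eventually.of_forall fun y hy x hx => ?_
        exact hM (y, x) ⟨uIoc_subset_uIcc hy, hx⟩
      · exact intervalIntegrable_const
      · exact Eventually.of_forall fun y _ x _ => hd y x
    · refine Continuous.continuousAt ?_
      exact (ContinuousLinearMap.toSpanSingletonCLE (𝕜 := ℝ) (E := ℝ)).continuous.comp hq
    · refine Continuous.continuousAt ?_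
      refine (ContinuousLinearMap.toSpanSingletonCLE (𝕜 := ℝ) (E := ℝ)).continuous.comp ?_
      refine intervalIntegral.continuous_parametric_intervalIntegral_of_continuous
        (f := fun (p : ℝ × ℝ) y => q' y p.2) (s := fun p => p.1) ?_ continuous_fst
      exact hq'.comp (by fun_prop : Continuous fun p : (ℝ × ℝ) × ℝ => (p.2, p.1.2))
  have h2 : HasDerivAt (fun s => (l s, s)) (l', 1) s := hl.prodMk (hasDerivAt_id s)
  have := HasFDerivAt.comp_hasDerivAt (f := fun s => (l s, s)) s key.hasFDerivAt h2
  refine this.congr_deriv ?_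
  simp [mul_comm]

lemma dw_smooth_dir (g : ℝ × ℝ → ℝ) (hg : ContDiff ℝ (⊤ : ℕ∞) g) (e : ℝ × ℝ) :
    ContDiff ℝ (⊤ : ℕ∞) (fun p => fderiv ℝ g p e) :=
  (hg.fderiv_right (m := (⊤ : ℕ∞)) (by simp)).clm_apply contDiff_const

lemma dw_hasDerivAt_curve (g : ℝ × ℝ → ℝ) (hg : ContDiff ℝ (⊤ : ℕ∞) g) (x t : ℝ → ℝ)
    (x' t' s : ℝ) (hx : HasDerivAt x x' s) (ht : HasDerivAt t t' s) :
    HasDerivAt (fun s => g (x s, t s))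
      (fderiv ℝ g (x s, t s) (1,0) * x' + fderiv ℝ g (x s, t s) (0,1) * t') s := by
  have h1 : HasFDerivAt g (fderiv ℝ g (x s, t s)) (x s, t s) :=
    (hg.differentiable (by simp) _).hasFDerivAt
  have h3 := HasFDerivAt.comp_hasDerivAt (f := fun s => (x s, t s)) s h1 (hx.prodMk ht)
  refine h3.congr_deriv ?_
  have : (x', t') = x' • ((1:ℝ),(0:ℝ)) + t' • ((0:ℝ),(1:ℝ)) := by simp
  rw [this, map_add, map_smul, map_smul]
  simp [mul_comm]

lemma dw_deriv_t (g : ℝ × ℝ → ℝ) (hg : ContDiff ℝ (⊤ : ℕ∞) g) (x s : ℝ) :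
    HasDerivAt (fun s => g (x, s)) (fderiv ℝ g (x, s) (0,1)) s := by
  simpa using dw_hasDerivAt_curve g hg (fun _ => x) (fun s => s) 0 1 s (hasDerivAt_const _ _)
    (hasDerivAt_id s)

lemma dw_deriv_x (g : ℝ × ℝ → ℝ) (hg : ContDiff ℝ (⊤ : ℕ∞) g) (x s : ℝ) :
    HasDerivAt (fun x => g (x, s)) (fderiv ℝ g (x, s) (1,0)) x := by
  simpa using dw_hasDerivAt_curve g hg (fun x => x) (fun _ => s) 1 0 x (hasDerivAt_id x)
    (hasDerivAt_const _ _)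

lemma dw_duhamel (u : ℝ × ℝ → ℝ) (hu : ContDiff ℝ (⊤ : ℕ∞) u) (F : ℝ × ℝ → ℝ)
    (hF : Continuous F) (hpde : ∀ p, waveOp u p = F p) (x t : ℝ) :
    u (x, t) = (1/2) * (u (x - t, 0) + u (x + t, 0))
      + (1/2) * (∫ y in (x - t)..(x + t), deriv (fun s => u (y, s)) 0)
      + (1/2) * ∫ s in (0:ℝ)..t, ∫ y in (x - t + s)..(x + t - s), F (y, s) := by
  set ut : ℝ × ℝ → ℝ := fun p => fderiv ℝ u p (0,1) with hut
  set ux : ℝ × ℝ → ℝ := fun p => fderiv ℝ u p (1,0) with hux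
  have sut : ContDiff ℝ (⊤ : ℕ∞) ut := dw_smooth_dir u hu _
  have sux : ContDiff ℝ (⊤ : ℕ∞) ux := dw_smooth_dir u hu _
  set utt : ℝ × ℝ → ℝ := fun p => fderiv ℝ ut p (0,1) with hutt
  set uxx : ℝ × ℝ → ℝ := fun p => fderiv ℝ ux p (1,0) with huxx
  have cutt : Continuous utt := (dw_smooth_dir ut sut _).continuous
  have cuxx : Continuous uxx := (dw_smooth_dir ux sux _).continuous
  have hFe : ∀ p, F p = utt p - uxx p := by
    intro p
    have e0 : ∀ g : ℝ → ℝ, iteratedDeriv 2 g = deriv (deriv g) := fun g => by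
      rw [iteratedDeriv_succ, iteratedDeriv_one]
    rw [← hpde p, waveOp, e0, e0]
    have e1 : deriv (fun s => u (p.1, s)) = fun s => ut (p.1, s) := by
      funext s; exact (dw_deriv_t u hu _ _).deriv
    have e2 : deriv (fun y => u (y, p.2)) = fun y => ux (y, p.2) := by
      funext s; exact (dw_deriv_x u hu _ _).deriv
    rw [e1, e2, (dw_deriv_t ut sut _ _).deriv, (dw_deriv_x ux sux _ _).deriv]
  have e1 : ∀ y, deriv (fun s => u (y, s)) 0 = ut (y, 0) := fun y => (dw_deriv_t u hu _ _).deriv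
  simp only [e1]
  have ii : ∀ (G : ℝ × ℝ → ℝ), Continuous G → ∀ s a b,
      IntervalIntegrable (fun y => G (y, s)) volume a b := fun G hG s a b =>
    (hG.comp (by fun_prop : Continuous fun y : ℝ => (y, s))).intervalIntegrable _ _
  set Φ : ℝ → ℝ := fun s => (1/2) * (u (x - t + s, s) + u (x + t - s, s))
    + (1/2) * ((∫ y in (0:ℝ)..(x + t - s), ut (y, s)) - ∫ y in (0:ℝ)..(x - t + s), ut (y, s))
    with hΦ
  have hl : ∀ s, HasDerivAt (fun s : ℝ => x - t + s) 1 s := fun s => by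
    simpa using (hasDerivAt_id s).const_add (x - t)
  have hr : ∀ s, HasDerivAt (fun s : ℝ => x + t - s) (-1) s := fun s => by
    simpa using (hasDerivAt_id s).const_sub (x + t)
  have hder : ∀ s, HasDerivAt Φ ((1/2) * ∫ y in (x - t + s)..(x + t - s), F (y, s)) s := by
    intro s
    have A := dw_hasDerivAt_curve u hu _ _ _ _ s (hl s) (hasDerivAt_id s)
    have B := dw_hasDerivAt_curve u hu _ _ _ _ s (hr s) (hasDerivAt_id s)
    have C := dw_prim_deriv (fun y s => ut (y, s)) (fun y s => utt (y, s)) sut.continuous cutt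
      (fun y s => dw_deriv_t ut sut y s) _ _ s (hr s)
    have D := dw_prim_deriv (fun y s => ut (y, s)) (fun y s => utt (y, s)) sut.continuous cutt
      (fun y s => dw_deriv_t ut sut y s) _ _ s (hl s)
    have E := ((A.add B).const_mul (1/2)).add ((C.sub D).const_mul (1/2))
    refine E.congr_deriv ?_
    have f1 : ∫ y in (x - t + s)..(x + t - s), F (y, s) =
        (∫ y in (x - t + s)..(x + t - s), utt (y, s))
         - ∫ y in (x - t + s)..(x + t - s), uxx (y, s) := by
      rw [← intervalIntegral.integral_sub (ii _ cutt _ _ _) (ii _ cuxx _ _ _)]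
      simp only [hFe]
    have f2 : ∫ y in (x - t + s)..(x + t - s), uxx (y, s) =
        ux (x + t - s, s) - ux (x - t + s, s) := by
      exact intervalIntegral.integral_eq_sub_of_hasDerivAt (f := fun y => ux (y, s))
        (fun y _ => dw_deriv_x ux sux y s) (ii _ cuxx _ _ _)
    have f3 : (∫ y in (x - t + s)..(x + t - s), utt (y, s)) =
        (∫ y in (0:ℝ)..(x + t - s), utt (y, s)) - ∫ y in (0:ℝ)..(x - t + s), utt (y, s) :=
      (intervalIntegral.integral_interval_sub_left (ii _ cutt _ _ _) (ii _ cutt _ _ _)).symm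
    rw [f1, f2, f3]
    simp only [hux, hut, id]
    ring
  have cont : Continuous fun s => (1/2) * ∫ y in (x - t + s)..(x + t - s), F (y, s) := by
    have hh : Continuous (Function.uncurry fun (s y : ℝ) => F (y, s)) :=
      hF.comp (by fun_prop : Continuous fun p : ℝ × ℝ => (p.2, p.1))
    have : ∀ s, ∫ y in (x - t + s)..(x + t - s), F (y, s) =
        (∫ y in (0:ℝ)..(x + t - s), F (y, s)) - ∫ y in (0:ℝ)..(x - t + s), F (y, s) := fun s =>
      (intervalIntegral.integral_interval_sub_left (ii _ hF _ _ _) (ii _ hF _ _ _)).symm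
    simp only [this]
    refine continuous_const.mul (Continuous.sub ?_ ?_)
    · exact intervalIntegral.continuous_parametric_intervalIntegral_of_continuous hh (by fun_prop)
    · exact intervalIntegral.continuous_parametric_intervalIntegral_of_continuous hh (by fun_prop)
  have ftc := intervalIntegral.integral_eq_sub_of_hasDerivAt (a := 0) (b := t)
    (fun s _ => hder s) (cont.intervalIntegrable _ _)
  rw [intervalIntegral.integral_const_mul] at ftc
  rw [ftc]
  have f4 : (∫ y in (x - t)..(x + t), ut (y, 0)) =
        (∫ y in (0:ℝ)..(x + t), ut (y, 0)) - ∫ y in (0:ℝ)..(x - t), ut (y, 0) :=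
      (intervalIntegral.integral_interval_sub_left (ii _ sut.continuous _ _ _)
        (ii _ sut.continuous _ _ _)).symm
  rw [f4]
  simp only [hΦ]
  have z1 : x - t + t = x := by ring
  have z2 : x + t - t = x := by ring
  rw [z1, z2]
  simp only [add_zero, sub_zero]
  ring

lemma dw_iter (φ : SchwartzMap ℝ ℝ) (α : ℕ) (ε y : ℝ) :
    iteratedDeriv α (fun y => ε⁻¹ * φ (y / ε)) y
      = ε⁻¹ * (ε⁻¹ ^ α * iteratedDeriv α φ (ε⁻¹ * y)) := by
  have h1 : (fun y => ε⁻¹ * φ (y / ε)) = fun y => ε⁻¹ * (fun z => φ (ε⁻¹ * z)) y := by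
    funext y; simp [div_eq_inv_mul]
  rw [h1, iteratedDeriv_const_mul_field, iteratedDeriv_comp_const_mul (φ.smooth α)]

lemma dw_lim_off (φ : SchwartzMap ℝ ℝ) (α : ℕ) (y : ℝ) (hy : y ≠ 0) :
    Tendsto (fun ε => iteratedDeriv α (fun y => ε⁻¹ * φ (y / ε)) y) (𝓝[>] (0:ℝ)) (𝓝 0) := by
  set M := SchwartzMap.seminorm ℝ (α + 2) α φ with hM
  have hlim : Tendsto (fun ε : ℝ => ε * (M / |y| ^ (α + 2))) (𝓝[>] (0:ℝ)) (𝓝 0) := by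
    have : Tendsto (fun ε : ℝ => ε * (M / |y| ^ (α + 2))) (𝓝 (0:ℝ)) (𝓝 (0 * (M / |y| ^ (α + 2)))) :=
      tendsto_id.mul_const _
    rw [zero_mul] at this
    exact this.mono_left nhdsWithin_le_nhds
  refine squeeze_zero_norm' ?_ hlim
  filter_upwards [self_mem_nhdsWithin] with ε hε
  have hε : 0 < ε := hε
  have h := φ.le_seminorm' ℝ (α + 2) α (ε⁻¹ * y)
  rw [← hM] at h
  have hy' : 0 < |y| := abs_pos.mpr hy
  rw [dw_iter, norm_mul, norm_mul, norm_pow, Real.norm_of_nonneg (inv_pos.mpr hε).le]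
  rw [abs_mul, abs_of_pos (inv_pos.mpr hε), mul_pow] at h
  set D := ‖iteratedDeriv α φ (ε⁻¹ * y)‖
  have e : ε⁻¹ * (ε⁻¹ ^ α * D) = ε * ((ε⁻¹ ^ (α + 2) * |y| ^ (α + 2) * D) / |y| ^ (α + 2)) := by
    rw [pow_add, inv_pow ε 2]
    field_simp
  rw [e]
  gcongr

lemma dw_int_succ (φ : SchwartzMap ℝ ℝ) (α : ℕ) (ε p q : ℝ) :
    ∫ y in p..q, iteratedDeriv (α + 1) (fun y => ε⁻¹ * φ (y / ε)) y
      = iteratedDeriv α (fun y => ε⁻¹ * φ (y / ε)) q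
        - iteratedDeriv α (fun y => ε⁻¹ * φ (y / ε)) p := by
  have hs : ContDiff ℝ (⊤ : ℕ∞) (fun y => ε⁻¹ * φ (y / ε)) :=
    contDiff_const.mul ((φ.smooth ⊤).comp (contDiff_id.div_const ε))
  refine intervalIntegral.integral_eq_sub_of_hasDerivAt (fun y _ => ?_) ?_
  · rw [iteratedDeriv_succ]
    exact ((hs.differentiable_iteratedDeriv α (by exact_mod_cast ENat.natCast_lt_top α)) y).hasDerivAt
  · exact (hs.continuous_iteratedDeriv (α + 1) (by exact_mod_cast le_top)).intervalIntegrable _ _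

lemma dw_lim_int_succ (φ : SchwartzMap ℝ ℝ) (α : ℕ) (p q : ℝ) (hp : p ≠ 0) (hq : q ≠ 0) :
    Tendsto (fun ε => ∫ y in p..q, iteratedDeriv (α + 1) (fun y => ε⁻¹ * φ (y / ε)) y)
      (𝓝[>] (0:ℝ)) (𝓝 0) := by
  simp only [dw_int_succ]
  simpa using (dw_lim_off φ α q hq).sub (dw_lim_off φ α p hp)

lemma dw_lim_int_zero (φ : SchwartzMap ℝ ℝ) (hφ1 : ∫ x : ℝ, φ x = 1)
    (p q : ℝ) (hp : p ≠ 0) (hq : q ≠ 0) (hpq : p < q) :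
    Tendsto (fun ε => ∫ y in p..q, iteratedDeriv 0 (fun y => ε⁻¹ * φ (y / ε)) y)
      (𝓝[>] (0:ℝ)) (𝓝 (if p < 0 ∧ 0 < q then 1 else 0)) := by
  have hi : Integrable φ := φ.integrable
  have hii : ∀ a b, IntervalIntegrable φ volume a b := fun a b => hi.intervalIntegrable
  have h1 : ∀ ε, ∫ y in p..q, iteratedDeriv 0 (fun y => ε⁻¹ * φ (y / ε)) y
      = (∫ y in (0:ℝ)..q / ε, φ y) - ∫ y in (0:ℝ)..p / ε, φ y := by
    intro ε
    simp only [iteratedDeriv_zero]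
    rw [intervalIntegral.integral_const_mul, intervalIntegral.inv_mul_integral_comp_div,
      intervalIntegral.integral_interval_sub_left (hii _ _) (hii _ _)]
  simp only [h1]
  have hpos : ∀ r : ℝ, 0 < r → Tendsto (fun ε => ∫ y in (0:ℝ)..r / ε, φ y) (𝓝[>] (0:ℝ))
      (𝓝 (∫ y in Ioi 0, φ y)) := by
    intro r hr
    refine intervalIntegral_tendsto_integral_Ioi 0 hi.integrableOn ?_
    exact (tendsto_inv_nhdsGT_zero.const_mul_atTop hr).congr
      fun ε => (div_eq_mul_inv _ _).symm
  have hneg : ∀ r : ℝ, r < 0 → Tendsto (fun ε => ∫ y in (0:ℝ)..r / ε, φ y) (𝓝[>] (0:ℝ))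
      (𝓝 (- ∫ y in Iic 0, φ y)) := by
    intro r hr
    simp only [intervalIntegral.integral_symm _ (0:ℝ)]
    refine (intervalIntegral_tendsto_integral_Iic 0 hi.integrableOn ?_).neg
    exact (tendsto_inv_nhdsGT_zero.const_mul_atTop_of_neg hr).congr
      fun ε => (div_eq_mul_inv _ _).symm
  have hsum : (∫ y in Ioi 0, φ y) - (- ∫ y in Iic 0, φ y) = 1 := by
    rw [← hφ1, ← intervalIntegral.integral_Iic_add_Ioi (b := 0) hi.integrableOn hi.integrableOn]
    ring
  rcases lt_or_gt_of_ne hp with hp | hp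
  · rcases lt_or_gt_of_ne hq with hq | hq
    · have : ¬ (p < 0 ∧ 0 < q) := fun h => by linarith [h.2]
      rw [if_neg this]
      simpa using (hneg q hq).sub (hneg p hp)
    · rw [if_pos ⟨hp, hq⟩, ← hsum]
      exact (hpos q hq).sub (hneg p hp)
  · have : ¬ (p < 0 ∧ 0 < q) := fun h => by linarith [h.1]
    rw [if_neg this]
    simpa using (hpos q (hp.trans hpq)).sub (hpos p hp)

lemma dw_v_lim (φ : SchwartzMap ℝ ℝ) (hφ1 : ∫ x : ℝ, φ x = 1)
    (J : ℕ) (xs : Fin J → ℝ) (m : ℕ) (c d : Fin J → Fin (m + 1) → ℝ)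
    (a b : ℝ → ℝ → ℝ)
    (hadef : ∀ ε ∈ Set.Ioc (0:ℝ) 1, ∀ x : ℝ,
      a ε x = ∑ j : Fin J, ∑ α : Fin (m + 1),
        c j α * iteratedDeriv (α : ℕ) (fun y => ε⁻¹ * φ (y / ε)) (x - xs j))
    (hbdef : ∀ ε ∈ Set.Ioc (0:ℝ) 1, ∀ x : ℝ,
      b ε x = ∑ j : Fin J, ∑ α : Fin (m + 1),
        d j α * iteratedDeriv (α : ℕ) (fun y => ε⁻¹ * φ (y / ε)) (x - xs j))
    (v : ℝ → ℝ × ℝ → ℝ)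
    (hvdef : ∀ ε ∈ Set.Ioc (0:ℝ) 1, ∀ x t : ℝ,
      v ε (x, t) = (1/2) * (a ε (x - t) + a ε (x + t))
        + (1/2) * ∫ y in (x - t)..(x + t), b ε y)
    (P : ℝ → ℝ → ℝ)
    (hPdef : ∀ x t : ℝ, P x t = (1/2) * ∑ j : Fin J, if |x - xs j| < t then d j 0 else 0)
    (x t : ℝ) (ht : 0 < t) (h1 : ∀ j, x - t ≠ xs j) (h2 : ∀ j, x + t ≠ xs j) :
    Tendsto (fun ε => v ε (x, t)) (𝓝[>] (0:ℝ)) (𝓝 (P x t)) := by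
  have hev : ∀ᶠ ε in 𝓝[>] (0:ℝ), ε ∈ Set.Ioc (0:ℝ) 1 :=
    Ioc_mem_nhdsGT (by norm_num)
  have ha : ∀ y, (∀ j, y ≠ xs j) → Tendsto (fun ε => a ε y) (𝓝[>] (0:ℝ)) (𝓝 0) := by
    intro y hy
    have : Tendsto (fun ε => ∑ j : Fin J, ∑ α : Fin (m + 1),
        c j α * iteratedDeriv (α : ℕ) (fun y => ε⁻¹ * φ (y / ε)) (y - xs j)) (𝓝[>] (0:ℝ))
        (𝓝 (∑ j : Fin J, ∑ α : Fin (m + 1), c j α * 0)) :=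
      tendsto_finsetSum _ fun j _ => tendsto_finsetSum _ fun α _ =>
        (dw_lim_off φ α _ (sub_ne_zero.mpr (hy j))).const_mul _
    simp only [mul_zero, Finset.sum_const_zero] at this
    refine this.congr' ?_
    filter_upwards [hev] with ε hε
    rw [hadef ε hε]
  have hcont : ∀ (ε : ℝ) (α : ℕ) (z : ℝ),
      Continuous fun y => iteratedDeriv α (fun y => ε⁻¹ * φ (y / ε)) (y - z) := by
    intro ε α z
    have hs : ContDiff ℝ (⊤ : ℕ∞) (fun y => ε⁻¹ * φ (y / ε)) :=
      contDiff_const.mul ((φ.smooth ⊤).comp (contDiff_id.div_const ε))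
    exact (hs.continuous_iteratedDeriv α (by exact_mod_cast le_top)).comp
      (continuous_id.sub continuous_const)
  have hb : ∀ ε ∈ Set.Ioc (0:ℝ) 1, ∫ y in (x - t)..(x + t), b ε y =
      ∑ j : Fin J, ∑ α : Fin (m + 1), d j α *
        ∫ y in (x - t - xs j)..(x + t - xs j),
          iteratedDeriv (α : ℕ) (fun y => ε⁻¹ * φ (y / ε)) y := by
    intro ε hε
    simp only [hbdef ε hε]
    rw [intervalIntegral.integral_finsetSum]
    · refine Finset.sum_congr rfl fun j _ => ?_
      rw [intervalIntegral.integral_finsetSum]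
      · refine Finset.sum_congr rfl fun α _ => ?_
        rw [intervalIntegral.integral_const_mul]
        congr 1
        exact intervalIntegral.integral_comp_sub_right
          (fun y => iteratedDeriv (α : ℕ) (fun y => ε⁻¹ * φ (y / ε)) y) (xs j)
      · intro α _
        exact (continuous_const.mul (hcont _ _ _)).intervalIntegrable _ _
    · intro j _
      exact (continuous_finsetSum _ fun α _ =>
        continuous_const.mul (hcont _ _ _)).intervalIntegrable _ _
  have hblim : Tendsto (fun ε => ∫ y in (x - t)..(x + t), b ε y) (𝓝[>] (0:ℝ))
      (𝓝 (∑ j : Fin J, if |x - xs j| < t then d j 0 else 0)) := by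
    have : Tendsto (fun ε => ∑ j : Fin J, ∑ α : Fin (m + 1), d j α *
        ∫ y in (x - t - xs j)..(x + t - xs j),
          iteratedDeriv (α : ℕ) (fun y => ε⁻¹ * φ (y / ε)) y) (𝓝[>] (0:ℝ))
        (𝓝 (∑ j : Fin J, if |x - xs j| < t then d j 0 else 0)) := by
      refine tendsto_finsetSum _ fun j _ => ?_
      have hp : x - t - xs j ≠ 0 := sub_ne_zero.mpr (h1 j)
      have hq : x + t - xs j ≠ 0 := sub_ne_zero.mpr (h2 j)
      simp only [Fin.sum_univ_succ]
      have e : (if |x - xs j| < t then d j 0 else 0) =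
          d j 0 * (if x - t - xs j < 0 ∧ 0 < x + t - xs j then 1 else 0)
            + ∑ α : Fin m, d j α.succ * 0 := by
        have : |x - xs j| < t ↔ (x - t - xs j < 0 ∧ 0 < x + t - xs j) := by
          rw [abs_lt]
          constructor
          · rintro ⟨h, h'⟩; constructor <;> linarith
          · rintro ⟨h, h'⟩; constructor <;> linarith
        simp [this]
      rw [e]
      refine Tendsto.add ?_ (tendsto_finsetSum _ fun α _ => ?_)
      · exact (dw_lim_int_zero φ hφ1 _ _ hp hq (by linarith)).const_mul _
      · exact (dw_lim_int_succ φ α _ _ hp hq).const_mul _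
    refine this.congr' ?_
    filter_upwards [hev] with ε hε
    rw [hb ε hε]
  have := (((ha _ h1).add (ha _ h2)).const_mul (1/2)).add (hblim.const_mul (1/2))
  rw [hPdef]
  rw [add_zero, mul_zero, zero_add] at this
  refine this.congr' ?_
  filter_upwards [hev] with ε hε
  rw [hvdef ε hε]

/-- The backward characteristic triangle. -/
def dwCone (x t : ℝ) : Set (ℝ × ℝ) :=
  {p | 0 < p.2 ∧ p.2 ≤ t ∧ x - t + p.2 < p.1 ∧ p.1 ≤ x + t - p.2}

lemma dwCone_meas (x t : ℝ) : MeasurableSet (dwCone x t) := by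
  have h1 : MeasurableSet {p : ℝ × ℝ | 0 < p.2} :=
    measurableSet_lt measurable_const measurable_snd
  have h2 : MeasurableSet {p : ℝ × ℝ | p.2 ≤ t} :=
    measurableSet_le measurable_snd measurable_const
  have h3 : MeasurableSet {p : ℝ × ℝ | x - t + p.2 < p.1} :=
    measurableSet_lt (by fun_prop) (by fun_prop)
  have h4 : MeasurableSet {p : ℝ × ℝ | p.1 ≤ x + t - p.2} :=
    measurableSet_le (by fun_prop) (by fun_prop)
  exact h1.inter (h2.inter (h3.inter h4))

lemma dwKT_compact (κ T : ℝ) : IsCompact (KT κ T) := by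
  have hc : IsClosed (KT κ T) := by
    have h1 : IsClosed {p : ℝ × ℝ | 0 ≤ p.2} := isClosed_le continuous_const continuous_snd
    have h2 : IsClosed {p : ℝ × ℝ | p.2 ≤ T} := isClosed_le continuous_snd continuous_const
    have h3 : IsClosed {p : ℝ × ℝ | |p.1| ≤ κ - p.2} := isClosed_le (by fun_prop) (by fun_prop)
    exact h1.inter (h2.inter h3)
  refine (isCompact_Icc (a := -κ) (b := κ)).prod (isCompact_Icc (a := 0) (b := T))
    |>.of_isClosed_subset hc ?_
  rintro ⟨x, t⟩ ⟨h1, h2, h3⟩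
  simp only at h1 h2 h3
  obtain ⟨h4, h5⟩ := abs_le.mp h3
  exact ⟨⟨by simp only; linarith, by simp only; linarith⟩, h1, h2⟩

lemma dwCone_sub (κ T x t : ℝ) (h : (x, t) ∈ KT κ T) : dwCone x t ⊆ KT κ T := by
  rintro ⟨y, s⟩ ⟨h1, h2, h3, h4⟩
  obtain ⟨g1, g2, g3⟩ := h
  simp only at *
  obtain ⟨h5, h6⟩ := abs_le.mp g3
  exact ⟨h1.le, by simp only; linarith, abs_le.mpr ⟨by simp only; linarith, by simp only; linarith⟩⟩

lemma dwCone_sub_rect (κ T x t : ℝ) (h : (x, t) ∈ KT κ T) :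
    dwCone x t ⊆ Icc (-κ) κ ×ˢ Ioc 0 t := by
  rintro ⟨y, s⟩ hp
  have hk := dwCone_sub κ T x t h hp
  obtain ⟨h1, h2, h3, h4⟩ := hp
  obtain ⟨g1, g2, g3⟩ := hk
  simp only at *
  obtain ⟨h5, h6⟩ := abs_le.mp g3
  exact ⟨⟨by simp only; linarith, by simp only; linarith⟩, h1, h2⟩

lemma dwCone_fin (x t : ℝ) : volume (dwCone x t) ≠ ⊤ := by
  have hsub : dwCone x t ⊆ Icc (x - t) (x + t) ×ˢ Icc 0 t := by
    rintro ⟨y, s⟩ ⟨h1, h2, h3, h4⟩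
    simp only at *
    exact ⟨⟨by simp only; linarith, by simp only; linarith⟩, h1.le, h2⟩
  exact ((measure_mono hsub).trans_lt (isCompact_Icc.prod isCompact_Icc).measure_lt_top).ne

lemma dw_integrableOn (s : Set (ℝ × ℝ)) (hs : volume s ≠ ⊤) (h : ℝ × ℝ → ℝ) (hm : Measurable h)
    (C : ℝ) (hC : ∀ p, |h p| ≤ C) : IntegrableOn h s := by
  refine Measure.integrableOn_of_bounded (M := C) hs hm.aestronglyMeasurable ?_
  exact Eventually.of_forall fun p => hC p

lemma dw_cone_integral (h : ℝ × ℝ → ℝ) (hm : Measurable h) (C : ℝ) (hC : ∀ p, |h p| ≤ C)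
    (x t : ℝ) (ht : 0 ≤ t) :
    ∫ s in (0:ℝ)..t, ∫ y in (x - t + s)..(x + t - s), h (y, s) = ∫ p in dwCone x t, h p := by
  have hint : Integrable ((dwCone x t).indicator h) :=
    (dw_integrableOn _ (dwCone_fin x t) h hm C hC).integrable_indicator (dwCone_meas x t)
  rw [← integral_indicator (dwCone_meas x t), Measure.volume_eq_prod, integral_prod_symm _ hint,
    intervalIntegral.integral_of_le ht, ← integral_indicator measurableSet_Ioc]
  congr 1
  funext s
  by_cases hs : s ∈ Ioc 0 t
  · rw [indicator_of_mem hs, intervalIntegral.integral_of_le (by linarith [hs.2]),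
      ← integral_indicator measurableSet_Ioc]
    congr 1
    funext y
    by_cases hy : y ∈ Ioc (x - t + s) (x + t - s)
    · rw [indicator_of_mem hy, indicator_of_mem]
      exact ⟨hs.1, hs.2, hy.1, hy.2⟩
    · rw [indicator_of_notMem hy, indicator_of_notMem]
      exact fun hh => hy ⟨hh.2.2.1, hh.2.2.2⟩
  · rw [indicator_of_notMem hs]
    have : ∀ y, (dwCone x t).indicator h (y, s) = 0 := fun y =>
      indicator_of_notMem (fun hh => hs ⟨hh.1, hh.2.1⟩) _
    simp [this]

lemma dw_gronwall (κ T L : ℝ) (hκ : 0 < κ) (hL : 0 ≤ L)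
    (D g : ℝ × ℝ → ℝ) (hD : Continuous D)
    (hg : Measurable g) (hg0 : ∀ p, 0 ≤ g p) (C : ℝ) (hgC : ∀ p, |g p| ≤ C)
    (h : ∀ p ∈ KT κ T, |D p| ≤ (1/2) * ∫ q in dwCone p.1 p.2, (L * |D q| + g q)) :
    ∀ p ∈ KT κ T, |D p| ≤ exp ((2 * L * κ + 1) * T) * ∫ q in KT κ T, g q := by
  intro p hp
  set lam := 2 * L * κ + 1 with hlam
  have hlam0 : 0 < lam := by positivity
  set G := ∫ q in KT κ T, g q with hG
  have hKf : volume (KT κ T) ≠ ⊤ := (dwKT_compact κ T).measure_lt_top.ne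
  have hG0 : 0 ≤ G := integral_nonneg hg0
  obtain ⟨p0, hp0, hmax⟩ := (dwKT_compact κ T).exists_isMaxOn ⟨p, hp⟩
    (f := fun q => exp (-(lam * q.2)) * |D q|) (by fun_prop)
  set N := exp (-(lam * p0.2)) * |D p0| with hN
  have hN0 : 0 ≤ N := by positivity
  have hbd : ∀ q ∈ KT κ T, |D q| ≤ N * exp (lam * q.2) := by
    intro q hq
    have h1 : exp (-(lam * q.2)) * |D q| ≤ N := hmax hq
    calc |D q| = (exp (-(lam * q.2)) * |D q|) * exp (lam * q.2) := by
          rw [mul_right_comm, ← exp_add]; simp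
      _ ≤ _ := by gcongr
  have hsub := dwCone_sub κ T p0.1 p0.2 hp0
  have hrect := dwCone_sub_rect κ T p0.1 p0.2 hp0
  have ht0 : 0 ≤ p0.2 := hp0.1
  -- integral of the exponential on the cone
  have hexpc : Continuous fun q : ℝ × ℝ => exp (lam * q.2) := by fun_prop
  have hRint : IntegrableOn (fun q : ℝ × ℝ => exp (lam * q.2)) (Icc (-κ) κ ×ˢ Ioc 0 p0.2) :=
    (hexpc.continuousOn.integrableOn_compact
      (isCompact_Icc.prod (isCompact_Icc (a := 0) (b := p0.2)))).mono_set
        (prod_mono le_rfl Ioc_subset_Icc_self)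
  have hexp : ∫ q in dwCone p0.1 p0.2, exp (lam * q.2) ≤ 2 * κ * (exp (lam * p0.2) / lam) := by
    calc ∫ q in dwCone p0.1 p0.2, exp (lam * q.2)
        ≤ ∫ q in Icc (-κ) κ ×ˢ Ioc 0 p0.2, exp (lam * q.2) :=
          setIntegral_mono_set hRint (Eventually.of_forall fun q => (exp_pos _).le)
            hrect.eventuallyLE
      _ = (∫ y in Icc (-κ) κ, (1:ℝ)) * ∫ s in Ioc 0 p0.2, exp (lam * s) := by
          rw [Measure.volume_eq_prod, ← setIntegral_prod_mul]
          simp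
      _ = 2 * κ * ((exp (lam * p0.2) - 1) / lam) := by
          congr 1
          · simp [hκ.le]; ring
          · rw [← intervalIntegral.integral_of_le ht0]
            rw [intervalIntegral.integral_comp_mul_left (fun s => exp s) hlam0.ne', integral_exp]
            simp [div_eq_inv_mul]
      _ ≤ _ := by gcongr; linarith
  have i1 : IntegrableOn (fun q => L * |D q|) (dwCone p0.1 p0.2) :=
    ((by fun_prop : Continuous fun q => L * |D q|).continuousOn.integrableOn_compact
      (dwKT_compact κ T)).mono_set hsub
  have i2 : IntegrableOn g (dwCone p0.1 p0.2) :=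
    dw_integrableOn _ (dwCone_fin _ _) g hg C hgC
  have i3 : IntegrableOn (fun q : ℝ × ℝ => L * N * exp (lam * q.2)) (dwCone p0.1 p0.2) :=
    (hRint.mono_set hrect).const_mul _
  have h2 := h p0 hp0
  rw [integral_add i1 i2] at h2
  have h3 : ∫ q in dwCone p0.1 p0.2, g q ≤ G :=
    setIntegral_mono_set (dw_integrableOn _ hKf g hg C hgC) (Eventually.of_forall hg0)
      hsub.eventuallyLE
  have h4 : ∫ q in dwCone p0.1 p0.2, L * |D q| ≤ L * N * (2 * κ * (exp (lam * p0.2) / lam)) := by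
    calc ∫ q in dwCone p0.1 p0.2, L * |D q|
        ≤ ∫ q in dwCone p0.1 p0.2, L * N * exp (lam * q.2) := by
          refine setIntegral_mono_on i1 i3 (dwCone_meas _ _) fun q hq => ?_
          rw [mul_assoc]
          exact mul_le_mul_of_nonneg_left (hbd q (hsub hq)) hL
      _ = L * N * ∫ q in dwCone p0.1 p0.2, exp (lam * q.2) := integral_const_mul _ _
      _ ≤ _ := by gcongr
  have h5 : |D p0| ≤ (1/2) * (L * N * (2 * κ * (exp (lam * p0.2) / lam)) + G) := by linarith
  have h6 : N ≤ (1/2) * N + (1/2) * G := by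
    have e1 : exp (-(lam * p0.2)) ≤ 1 := by
      rw [exp_le_one_iff]; nlinarith [mul_nonneg hlam0.le ht0]
    have e2 : exp (-(lam * p0.2)) * exp (lam * p0.2) = 1 := by rw [← exp_add]; simp
    have e3 : (2 * L * κ) / lam ≤ 1 := by rw [div_le_one hlam0]; linarith
    calc N ≤ exp (-(lam * p0.2)) *
          ((1/2) * (L * N * (2 * κ * (exp (lam * p0.2) / lam)) + G)) :=
          mul_le_mul_of_nonneg_left h5 (exp_pos _).le
      _ = (1/2) * N * ((2 * L * κ) / lam) * (exp (-(lam * p0.2)) * exp (lam * p0.2))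
          + (1/2) * (exp (-(lam * p0.2)) * G) := by ring
      _ ≤ (1/2) * N * 1 * 1 + (1/2) * (1 * G) := by
          rw [e2]; gcongr
      _ = _ := by ring
  have h7 : N ≤ G := by linarith
  calc |D p| ≤ N * exp (lam * p.2) := hbd p hp
    _ ≤ G * exp (lam * T) := by gcongr; exact hp.2.1
    _ = _ := mul_comm _ _

lemma dw_ae_line (k r c : ℝ) (hr : r ≠ 0) : ∀ᵐ p : ℝ × ℝ, k * p.1 + r * p.2 ≠ c := by
  rw [ae_iff]
  simp only [not_not]
  have hm : MeasurableSet {p : ℝ × ℝ | k * p.1 + r * p.2 = c} :=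
    measurableSet_eq_fun (by fun_prop) (by fun_prop)
  rw [Measure.volume_eq_prod, Measure.measure_prod_null hm]
  refine Eventually.of_forall fun x => ?_
  have : Prod.mk x ⁻¹' {p : ℝ × ℝ | k * p.1 + r * p.2 = c} ⊆ {(c - k * x) / r} := by
    intro s hs
    have hs : k * x + r * s = c := hs
    rw [mem_singleton_iff, eq_div_iff hr]
    linarith
  exact measure_mono_null this (by simp)

/-- Delta waves: for initial data given by linear combinations of derivatives of
mollified Dirac measures at points `x_1 < … < x_J`, the classical solutions `u_ε`
of the semilinear wave equation converge in `L¹(K_T)` to `v_ε + w`, where `v_ε`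
is the free wave with the singular data and `w` is the continuous solution of
the equation driven by the piecewise constant delta-wave profile `P`. -/
theorem delta_waves
    (f : ℝ → ℝ) (hf : Admissible f) (B : ℝ) (hfB : ∀ y : ℝ, |f y| ≤ B)
    (φ : SchwartzMap ℝ ℝ) (hφ1 : ∫ x : ℝ, φ x = 1)
    (hφmom : ∀ k : ℕ, 1 ≤ k → ∫ x : ℝ, x ^ k * φ x = 0)
    (J : ℕ) (hJ : 0 < J) (xs : Fin J → ℝ) (hxs : StrictMono xs)
    (m : ℕ) (c d : Fin J → Fin (m + 1) → ℝ)
    (a b : ℝ → ℝ → ℝ)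
    (hadef : ∀ ε ∈ Set.Ioc (0:ℝ) 1, ∀ x : ℝ,
      a ε x = ∑ j : Fin J, ∑ α : Fin (m + 1),
        c j α * iteratedDeriv (α : ℕ) (fun y => ε⁻¹ * φ (y / ε)) (x - xs j))
    (hbdef : ∀ ε ∈ Set.Ioc (0:ℝ) 1, ∀ x : ℝ,
      b ε x = ∑ j : Fin J, ∑ α : Fin (m + 1),
        d j α * iteratedDeriv (α : ℕ) (fun y => ε⁻¹ * φ (y / ε)) (x - xs j))
    (v : ℝ → ℝ × ℝ → ℝ)
    (hvdef : ∀ ε ∈ Set.Ioc (0:ℝ) 1, ∀ x t : ℝ,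
      v ε (x, t) = (1/2) * (a ε (x - t) + a ε (x + t))
        + (1/2) * ∫ y in (x - t)..(x + t), b ε y)
    (P : ℝ → ℝ → ℝ)
    (hPdef : ∀ x t : ℝ, P x t = (1/2) * ∑ j : Fin J, if |x - xs j| < t then d j 0 else 0)
    (w : ℝ × ℝ → ℝ) (hwcont : ContinuousOn w {p : ℝ × ℝ | 0 ≤ p.2})
    (hweq : ∀ x t : ℝ, 0 ≤ t →
      w (x, t) = (1/2) * ∫ s in (0:ℝ)..t, ∫ y in (x - t + s)..(x + t - s),
        f (P y s + w (y, s)))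
    (u : ℝ → ℝ × ℝ → ℝ)
    (husmooth : ∀ ε ∈ Set.Ioc (0:ℝ) 1, ContDiff ℝ (⊤ : ℕ∞) (u ε))
    (hpde : ∀ ε ∈ Set.Ioc (0:ℝ) 1, ∀ p : ℝ × ℝ, waveOp (u ε) p = f (u ε p))
    (hinit0 : ∀ ε ∈ Set.Ioc (0:ℝ) 1, ∀ x : ℝ, u ε (x, 0) = a ε x)
    (hinit1 : ∀ ε ∈ Set.Ioc (0:ℝ) 1, ∀ x : ℝ, deriv (fun s => u ε (x, s)) 0 = b ε x) :
    ∀ κ : ℝ, 0 < κ → ∀ T : ℝ, 0 ≤ T → T ≤ κ →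
      Tendsto (fun ε => ∫ p in KT κ T, |u ε p - v ε p - w p|) (𝓝[>] (0:ℝ)) (𝓝 0) := by
  intro κ hκ T hT hTκ
  obtain ⟨hfs, hf0, ⟨L, hL⟩, -⟩ := hf
  have hL0 : 0 ≤ L := (abs_nonneg _).trans (hL 0)
  have hfc : Continuous f := hfs.continuous
  have hlip : ∀ y z, |f y - f z| ≤ L * |y - z| := by
    intro y z
    have := Convex.norm_image_sub_le_of_norm_deriv_le (𝕜 := ℝ) (f := f) (s := univ) (C := L)
      (fun x _ => hfs.differentiable (by simp) x) (fun x _ => hL x) convex_univ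
      (mem_univ z) (mem_univ y)
    simpa using this
  -- globally continuous version of w
  set W : ℝ × ℝ → ℝ := fun p => w (p.1, max p.2 0) with hW
  have hWc : Continuous W := by
    refine hwcont.comp_continuous (by fun_prop) fun p => ?_
    exact le_max_right p.2 (0:ℝ)
  have hWw : ∀ y s : ℝ, 0 ≤ s → W (y, s) = w (y, s) := by
    intro y s hs
    simp [hW, hs]
  have hPm : Measurable fun p : ℝ × ℝ => P p.1 p.2 := by
    simp only [hPdef]
    refine measurable_const.mul (Finset.measurable_sum _ fun j _ => ?_)
    refine Measurable.ite ?_ measurable_const measurable_const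
    exact measurableSet_lt (by fun_prop) (by fun_prop)
  have hPWm : Measurable fun p : ℝ × ℝ => f (P p.1 p.2 + W p) :=
    hfc.measurable.comp (hPm.add hWc.measurable)
  have hev : ∀ᶠ ε in 𝓝[>] (0:ℝ), ε ∈ Set.Ioc (0:ℝ) 1 :=
    Ioc_mem_nhdsGT (by norm_num)
  have hbc : ∀ ε ∈ Set.Ioc (0:ℝ) 1, Continuous (b ε) := by
    intro ε hε
    have : b ε = fun x => fderiv ℝ (u ε) (x, 0) (0, 1) := by
      funext x
      rw [← hinit1 ε hε, (dw_deriv_t (u ε) (husmooth ε hε) x 0).deriv]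
    rw [this]
    exact (dw_smooth_dir (u ε) (husmooth ε hε) (0,1)).continuous.comp
      (by fun_prop : Continuous fun x : ℝ => (x, (0:ℝ)))
  have hvc : ∀ ε ∈ Set.Ioc (0:ℝ) 1, Continuous (v ε) := by
    intro ε hε
    have huc := (husmooth ε hε).continuous
    have hb := hbc ε hε
    have : v ε = fun p => (1/2) * (u ε (p.1 - p.2, 0) + u ε (p.1 + p.2, 0))
        + (1/2) * ((∫ y in (0:ℝ)..(p.1 + p.2), b ε y) - ∫ y in (0:ℝ)..(p.1 - p.2), b ε y) := by
      funext p
      rw [intervalIntegral.integral_interval_sub_left (hb.intervalIntegrable _ _)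
        (hb.intervalIntegrable _ _), hinit0 ε hε, hinit0 ε hε]
      exact hvdef ε hε p.1 p.2
    rw [this]
    have hprim : Continuous fun x => ∫ y in (0:ℝ)..x, b ε y :=
      intervalIntegral.continuous_primitive (fun _ _ => hb.intervalIntegrable _ _) 0
    have c1 : Continuous fun p : ℝ × ℝ => ∫ y in (0:ℝ)..(p.1 + p.2), b ε y :=
      hprim.comp (by fun_prop : Continuous fun p : ℝ × ℝ => p.1 + p.2)
    have c2 : Continuous fun p : ℝ × ℝ => ∫ y in (0:ℝ)..(p.1 - p.2), b ε y :=
      hprim.comp (by fun_prop : Continuous fun p : ℝ × ℝ => p.1 - p.2)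
    fun_prop
  have hKf : volume (KT κ T) ≠ ⊤ := (dwKT_compact κ T).measure_lt_top.ne
  have hKm : MeasurableSet (KT κ T) := (dwKT_compact κ T).measurableSet
  set g : ℝ → ℝ × ℝ → ℝ := fun ε p => |f (v ε p + W p) - f (P p.1 p.2 + W p)| with hg
  have hgm : ∀ ε ∈ Set.Ioc (0:ℝ) 1, Measurable (g ε) := by
    intro ε hε
    have h1 : Measurable fun p => f (v ε p + W p) :=
      (hfc.comp ((hvc ε hε).add hWc)).measurable
    exact (h1.sub hPWm).norm
  have hgB : ∀ ε p, |g ε p| ≤ 2 * B := by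
    intro ε p
    rw [hg, abs_abs]
    refine (norm_sub_le (f (v ε p + W p)) (f (P p.1 p.2 + W p))).trans ?_
    simp only [Real.norm_eq_abs]
    linarith [hfB (v ε p + W p), hfB (P p.1 p.2 + W p)]
  -- the Gronwall estimate
  have hest : ∀ ε ∈ Set.Ioc (0:ℝ) 1, ∀ p ∈ KT κ T,
      |u ε p - v ε p - W p| ≤ exp ((2 * L * κ + 1) * T) * ∫ q in KT κ T, g ε q := by
    intro ε hε
    have huc := (husmooth ε hε).continuous
    have hvc' := hvc ε hε
    have hDc : Continuous fun p => u ε p - v ε p - W p := by fun_prop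
    refine dw_gronwall κ T L hκ hL0 (fun p => u ε p - v ε p - W p) (g ε) hDc
      (hgm ε hε) (fun p => abs_nonneg _) (2 * B) (hgB ε) ?_
    rintro ⟨x, t⟩ hp
    have ht : 0 ≤ t := hp.1
    have hfu : Measurable fun p => f (u ε p) := (hfc.comp huc).measurable
    have hduh := dw_duhamel (u ε) (husmooth ε hε) (fun p => f (u ε p)) (hfc.comp huc)
      (hpde ε hε) x t
    simp only [hinit0 ε hε, hinit1 ε hε] at hduh
    rw [← hvdef ε hε, dw_cone_integral (fun p => f (u ε p)) hfu B (fun p => hfB _) x t ht] at hduh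
    have hw2 : W (x, t) = (1/2) * ∫ q in dwCone x t, f (P q.1 q.2 + W q) := by
      rw [hWw x t ht, hweq x t ht,
        ← dw_cone_integral (fun q => f (P q.1 q.2 + W q)) hPWm B (fun p => hfB _) x t ht]
      congr 1
      refine intervalIntegral.integral_congr fun s hs => ?_
      rw [uIcc_of_le ht] at hs
      simp only [hWw _ s hs.1]
    have i1 : IntegrableOn (fun p => f (u ε p)) (dwCone x t) :=
      dw_integrableOn _ (dwCone_fin _ _) _ hfu B (fun p => hfB _)
    have i2 : IntegrableOn (fun q : ℝ × ℝ => f (P q.1 q.2 + W q)) (dwCone x t) :=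
      dw_integrableOn _ (dwCone_fin _ _) _ hPWm B (fun p => hfB _)
    have i3 : IntegrableOn (fun q => L * |u ε q - v ε q - W q| + g ε q) (dwCone x t) := by
      refine Integrable.add ?_ (dw_integrableOn _ (dwCone_fin _ _) _ (hgm ε hε) _ (hgB ε))
      exact ((by fun_prop : Continuous fun q =>
        L * |u ε q - v ε q - W q|).continuousOn.integrableOn_compact
          (dwKT_compact κ T)).mono_set (dwCone_sub κ T x t hp)
    have hD : u ε (x, t) - v ε (x, t) - W (x, t) =
        (1/2) * ∫ q in dwCone x t, (f (u ε q) - f (P q.1 q.2 + W q)) := by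
      rw [integral_sub i1 i2, hw2]
      linarith
    simp only
    rw [hD, abs_mul, abs_of_pos (by norm_num : (0:ℝ) < 1/2)]
    refine mul_le_mul_of_nonneg_left ?_ (by norm_num)
    refine abs_integral_le_integral_abs.trans ?_
    refine integral_mono (i1.sub i2).abs i3 fun q => ?_
    have e : f (u ε q) - f (P q.1 q.2 + W q) =
      (f (u ε q) - f (v ε q + W q)) + (f (v ε q + W q) - f (P q.1 q.2 + W q)) := by ring
    simp only
    rw [e]
    refine (abs_add_le _ _).trans ?_
    refine add_le_add ?_ le_rfl
    have := hlip (u ε q) (v ε q + W q)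
    rwa [← sub_sub] at this
  -- the driving term tends to zero
  have hGlim : Tendsto (fun ε => ∫ q in KT κ T, g ε q) (𝓝[>] (0:ℝ)) (𝓝 0) := by
    have : Tendsto (fun ε => ∫ q in KT κ T, g ε q) (𝓝[>] (0:ℝ))
        (𝓝 (∫ q in KT κ T, (fun _ => (0:ℝ)) q)) := by
      refine tendsto_integral_filter_of_dominated_convergence (fun _ => 2 * B) ?_ ?_ ?_ ?_
      · filter_upwards [hev] with ε hε
        exact (hgm ε hε).aestronglyMeasurable
      · exact Eventually.of_forall fun ε => Eventually.of_forall fun p => hgB ε p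
      · exact integrableOn_const hKf
      · have a1 : ∀ᵐ p : ℝ × ℝ, ∀ j, 1 * p.1 + (-1) * p.2 ≠ xs j :=
          ae_all_iff.mpr fun j => dw_ae_line 1 (-1) (xs j) (by norm_num)
        have a2 : ∀ᵐ p : ℝ × ℝ, ∀ j, 1 * p.1 + 1 * p.2 ≠ xs j :=
          ae_all_iff.mpr fun j => dw_ae_line 1 1 (xs j) (by norm_num)
        have a3 := dw_ae_line 0 1 0 (by norm_num)
        filter_upwards [ae_restrict_mem hKm, ae_restrict_of_ae a1, ae_restrict_of_ae a2,
          ae_restrict_of_ae a3] with p hp h1 h2 h3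
        have ht : 0 < p.2 := lt_of_le_of_ne hp.1 (fun h => h3 (by simp [← h]))
        have hv := dw_v_lim φ hφ1 J xs m c d a b hadef hbdef v hvdef P hPdef p.1 p.2 ht
          (fun j hj => h1 j (by linarith)) (fun j hj => h2 j (by linarith))
        have h4 : Tendsto (fun ε => f (v ε p + W p)) (𝓝[>] (0:ℝ)) (𝓝 (f (P p.1 p.2 + W p))) :=
          (hfc.tendsto _).comp (hv.add_const _)
        have h5 := (h4.sub_const (f (P p.1 p.2 + W p))).abs
        simpa using h5
    simpa using this
  have hlim2 : Tendsto (fun ε => (exp ((2 * L * κ + 1) * T) * ∫ q in KT κ T, g ε q)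
      * volume.real (KT κ T)) (𝓝[>] (0:ℝ)) (𝓝 0) := by
    have := (hGlim.const_mul (exp ((2 * L * κ + 1) * T))).mul_const (volume.real (KT κ T))
    simpa using this
  refine squeeze_zero_norm' ?_ hlim2
  filter_upwards [hev] with ε hε
  refine norm_setIntegral_le_of_norm_le_const hKf.lt_top fun p hp => ?_
  rw [norm_abs_eq_norm, ← hWw p.1 p.2 hp.1]
  exact hest ε hε p hp
end
end

section
/- Let f : ℝ → ℝ be continuous and globally Lipschitz with f(0) = 0, and let g : ℝ×[0,∞) → ℝ be measurable and bounded. Then there exists a unique continuous function w : ℝ×[0,∞) → ℝ such that w(x,t) = ½∫_0^t∫_{x−t+s}^{x+t−s} f(g(y,s) + w(y,s)) dy ds for all x ∈ ℝ and t ≥ 0. -/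
open Real Set Filter MeasureTheory Topology

noncomputable section

/-- Integral over the backward cone. -/
def coneJ (h : ℝ → ℝ → ℝ) (x t : ℝ) : ℝ :=
  ∫ s in (0:ℝ)..t, ∫ y in (x - t + s)..(x + t - s), h y s

/-- Slice with clipped radius. -/
def coneI (h : ℝ → ℝ → ℝ) (x t s : ℝ) : ℝ :=
  ∫ y in (x - max (t - s) 0)..(x + max (t - s) 0), h y s

/-- Local boundedness. -/
def LB (h : ℝ → ℝ → ℝ) : Prop :=
  ∀ R : ℝ, ∃ C : ℝ, ∀ y s : ℝ, |y| ≤ R → |s| ≤ R → |h y s| ≤ C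

lemma slice_intble {h : ℝ → ℝ → ℝ} (hm : Measurable (Function.uncurry h)) (hb : LB h)
    (s a b : ℝ) : IntervalIntegrable (fun y => h y s) volume a b := by
  obtain ⟨C, hC⟩ := hb (max (max |a| |b|) |s|)
  have hmeas : Measurable (fun y => h y s) :=
    hm.comp (measurable_id.prodMk measurable_const)
  rw [intervalIntegrable_iff]
  refine Measure.integrableOn_of_bounded (M := C) ?_ hmeas.aestronglyMeasurable ?_
  · simp [uIoc]
  · refine (ae_restrict_iff' measurableSet_uIoc).2 (ae_of_all _ fun y hy => ?_)
    refine hC y s ?_ (le_max_right _ _)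
    refine le_trans ?_ (le_max_left _ _)
    have := uIoc_subset_uIcc hy
    rw [mem_uIcc] at this
    rcases this with h | h
    · exact abs_le_max_abs_abs h.1 h.2
    · rw [max_comm]; exact abs_le_max_abs_abs h.1 h.2

lemma coneI_meas {h : ℝ → ℝ → ℝ} (hm : Measurable (Function.uncurry h)) (x t : ℝ) :
    Measurable (fun s => coneI h x t s) := by
  have h1 : ∀ s, coneI h x t s =
      max (t - s) 0 * ∫ z in (-1:ℝ)..1, h (max (t - s) 0 * z + x) s := by
    intro s
    have := intervalIntegral.smul_integral_comp_mul_add (a := -1) (b := 1)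
      (fun y => h y s) (max (t - s) 0) x
    rw [smul_eq_mul] at this
    rw [this, coneI]
    congr 1 <;> ring
  simp_rw [h1]
  refine Measurable.mul (by fun_prop) ?_
  simp_rw [intervalIntegral.integral_of_le (show (-1:ℝ) ≤ 1 by norm_num)]
  have : StronglyMeasurable (fun p : ℝ × ℝ => h (max (t - p.1) 0 * p.2 + x) p.1) := by
    refine Measurable.stronglyMeasurable ?_
    exact hm.comp (Measurable.prodMk (by fun_prop) (by fun_prop))
  exact (StronglyMeasurable.integral_prod_right' (ν := volume.restrict (Ioc (-1:ℝ) 1)) this).measurable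

lemma coneI_eq {h : ℝ → ℝ → ℝ} {x t s : ℝ} (hs : s ≤ t) :
    coneI h x t s = ∫ y in (x - t + s)..(x + t - s), h y s := by
  rw [coneI, max_eq_left (by linarith)]
  congr 1 <;> ring

lemma coneJ_eq (h : ℝ → ℝ → ℝ) {x t T : ℝ} (ht : 0 ≤ t) (hT : t ≤ T) :
    coneJ h x t = ∫ s in (0:ℝ)..T, coneI h x t s := by
  rw [coneJ, intervalIntegral.integral_of_le ht, intervalIntegral.integral_of_le (ht.trans hT)]
  rw [setIntegral_eq_of_subset_of_forall_sdiff_eq_zero (s := Ioc 0 t) (t := Ioc 0 T)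
    measurableSet_Ioc (Ioc_subset_Ioc_right hT)]
  · exact setIntegral_congr_fun measurableSet_Ioc fun s hs => (coneI_eq hs.2).symm
  · intro s hs
    have : t < s := by
      by_contra hc
      exact hs.2 ⟨hs.1.1, not_lt.1 hc⟩
    rw [coneI, max_eq_right (by linarith)]
    simp

lemma coneI_bound {h : ℝ → ℝ → ℝ} (hb : LB h) (R : ℝ) :
    ∃ C : ℝ, ∀ x t s : ℝ, |x| ≤ R → |t| ≤ R → |s| ≤ R → |coneI h x t s| ≤ C := by
  obtain ⟨C, hC⟩ := hb (3 * R)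
  refine ⟨|C| * (4 * R), fun x t s hx ht hs => ?_⟩
  have hR : 0 ≤ R := (abs_nonneg _).trans hx
  rw [abs_le] at hx ht hs
  have hr : max (t - s) 0 ≤ 2 * R := max_le (by linarith) (by linarith)
  have hr0 : 0 ≤ max (t - s) 0 := le_max_right _ _
  have := intervalIntegral.norm_integral_le_of_norm_le_const (f := fun y => h y s) (C := |C|)
    (a := x - max (t - s) 0) (b := x + max (t - s) 0) (by
      intro y hy
      rw [uIoc_of_le (by linarith)] at hy
      refine (hC y s ?_ ?_).trans (le_abs_self _)
      · rw [abs_le]; constructor <;> linarith [hy.1, hy.2]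
      · rw [abs_le]; constructor <;> linarith)
  refine this.trans ?_
  refine mul_le_mul_of_nonneg_left ?_ (abs_nonneg _)
  rw [abs_of_nonneg (by linarith)]
  linarith

lemma coneI_intble {h : ℝ → ℝ → ℝ} (hm : Measurable (Function.uncurry h)) (hb : LB h)
    (x t a b : ℝ) : IntervalIntegrable (fun s => coneI h x t s) volume a b := by
  obtain ⟨C, hC⟩ := coneI_bound hb (max (max |a| |b|) (max |x| |t|))
  rw [intervalIntegrable_iff]
  refine Measure.integrableOn_of_bounded (M := C) ?_ (coneI_meas hm x t).aestronglyMeasurable ?_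
  · simp [uIoc]
  · refine (ae_restrict_iff' measurableSet_uIoc).2 (ae_of_all _ fun y hy => ?_)
    refine hC x t y ((le_max_left _ _).trans (le_max_right _ _))
      ((le_max_right _ _).trans (le_max_right _ _)) ?_
    refine le_trans ?_ (le_max_left _ _)
    have := uIoc_subset_uIcc hy
    rw [mem_uIcc] at this
    rcases this with h | h
    · exact abs_le_max_abs_abs h.1 h.2
    · rw [max_comm]; exact abs_le_max_abs_abs h.1 h.2

lemma coneI_cont {h : ℝ → ℝ → ℝ} (hm : Measurable (Function.uncurry h)) (hb : LB h) (s : ℝ) :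
    Continuous (fun p : ℝ × ℝ => coneI h p.1 p.2 s) := by
  have hi := fun a b => slice_intble hm hb s a b
  have hc := intervalIntegral.continuous_primitive hi 0
  have : ∀ p : ℝ × ℝ, coneI h p.1 p.2 s =
      (∫ y in (0:ℝ)..(p.1 + max (p.2 - s) 0), h y s)
        - ∫ y in (0:ℝ)..(p.1 - max (p.2 - s) 0), h y s := by
    intro p
    rw [intervalIntegral.integral_interval_sub_left (hi _ _) (hi _ _), coneI]
  simp_rw [this]
  exact (hc.comp (by fun_prop : Continuous fun p : ℝ × ℝ => p.1 + max (p.2 - s) 0)).sub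
    (hc.comp (by fun_prop : Continuous fun p : ℝ × ℝ => p.1 - max (p.2 - s) 0))

lemma coneJ_cont {h : ℝ → ℝ → ℝ} (hm : Measurable (Function.uncurry h)) (hb : LB h) :
    Continuous (fun p : ℝ × ℝ => coneJ h p.1 (max p.2 0)) := by
  rw [continuous_iff_continuousAt]
  rintro ⟨x₀, t₀⟩
  set R := |x₀| + |t₀| + 1 with hR
  have hR0 : 0 ≤ R := by positivity
  have hx₀ : |x₀| < R := by have := abs_nonneg t₀; linarith
  have ht₀ : |t₀| < R := by have := abs_nonneg x₀; linarith
  have hev : ∀ᶠ p : ℝ × ℝ in 𝓝 (x₀, t₀), |p.1| < R ∧ |p.2| < R := by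
    refine IsOpen.mem_nhds (s := {p : ℝ × ℝ | |p.1| < R ∧ |p.2| < R}) ?_ ⟨hx₀, ht₀⟩
    have o1 : IsOpen {p : ℝ × ℝ | |p.1| < R} := isOpen_lt (by fun_prop) (by fun_prop)
    have o2 : IsOpen {p : ℝ × ℝ | |p.2| < R} := isOpen_lt (by fun_prop) (by fun_prop)
    exact o1.inter o2
  have hmx : ∀ t : ℝ, |t| < R → max t 0 ≤ R ∧ |max t 0| ≤ R := by
    intro t ht
    have : max t 0 ≤ R := max_le ((le_abs_self _).trans ht.le) hR0
    exact ⟨this, by rwa [abs_of_nonneg (le_max_right _ _)]⟩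
  have heq : (fun p : ℝ × ℝ => coneJ h p.1 (max p.2 0)) =ᶠ[𝓝 (x₀, t₀)]
      fun p => ∫ s in (0:ℝ)..R, coneI h p.1 (max p.2 0) s := by
    filter_upwards [hev] with p hp
    exact coneJ_eq h (le_max_right _ _) (hmx _ hp.2).1
  refine ContinuousAt.congr ?_ heq.symm
  obtain ⟨C, hC⟩ := coneI_bound hb R
  refine intervalIntegral.continuousAt_of_dominated_interval (bound := fun _ => C) ?_ ?_ ?_ ?_
  · exact Eventually.of_forall fun p => (coneI_meas hm _ _).aestronglyMeasurable
  · filter_upwards [hev] with p hp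
    refine ae_of_all _ fun s hs => ?_
    rw [uIoc_of_le hR0] at hs
    exact hC _ _ _ hp.1.le (hmx _ hp.2).2 (by rw [abs_of_pos hs.1]; exact hs.2)
  · exact intervalIntegrable_const
  · refine ae_of_all _ fun s _ => ?_
    exact ((coneI_cont hm hb s).comp
      (by fun_prop : Continuous fun p : ℝ × ℝ => (p.1, max p.2 0))).continuousAt

lemma exp_int {l : ℝ} (hl : 0 < l) {t : ℝ} (ht : 0 ≤ t) :
    ∫ s in (0:ℝ)..t, (t - s) * exp (l * s) ≤ exp (l * t) / l ^ 2 := by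
  have hd : ∀ s ∈ uIcc 0 t, HasDerivAt
      (fun s => (t - s) * (exp (l * s) / l) + exp (l * s) / l ^ 2) ((t - s) * exp (l * s)) s := by
    intro s _
    have h1 : HasDerivAt (fun s => exp (l * s)) (exp (l * s) * l) s := by
      simpa using ((hasDerivAt_id s).const_mul l).exp
    have h2 : HasDerivAt (fun s => t - s) (-1) s := (hasDerivAt_id s).const_sub t
    refine ((h2.mul (h1.div_const l)).add (h1.div_const (l ^ 2))).congr_deriv ?_
    field_simp
    ring
  rw [intervalIntegral.integral_eq_sub_of_hasDerivAt hd
    (Continuous.intervalIntegrable (by fun_prop) _ _)]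
  have h1 : 0 ≤ t * (1 / l) := by positivity
  have h2 : 0 ≤ 1 / l ^ 2 := by positivity
  simp only [sub_self, zero_mul, zero_add, mul_zero, exp_zero, sub_zero]
  linarith

lemma coneJ_bound {h : ℝ → ℝ → ℝ} {l C x t : ℝ} (hl : 0 < l) (ht : 0 ≤ t) (hC0 : 0 ≤ C)
    (hC : ∀ y s, 0 ≤ s → |y - x| + s ≤ t → |h y s| ≤ C * exp (l * s)) :
    |coneJ h x t| ≤ 2 * C * (exp (l * t) / l ^ 2) := by
  have h1 : ‖coneJ h x t‖ ≤ ∫ s in (0:ℝ)..t, 2 * C * ((t - s) * exp (l * s)) := by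
    refine intervalIntegral.norm_integral_le_of_norm_le ht (ae_of_all _ fun s hs => ?_)
      (Continuous.intervalIntegrable (by fun_prop) _ _)
    refine (intervalIntegral.norm_integral_le_of_norm_le_const (C := C * exp (l * s)) ?_).trans ?_
    · intro y hy
      rw [uIoc_of_le (by linarith [hs.2])] at hy
      refine hC y s hs.1.le ?_
      have : |y - x| ≤ t - s := by rw [abs_le]; constructor <;> linarith [hy.1, hy.2]
      linarith
    · rw [abs_of_nonneg (by linarith [hs.2])]
      apply le_of_eq; ring
  rw [intervalIntegral.integral_const_mul] at h1
  exact h1.trans (mul_le_mul_of_nonneg_left (exp_int hl ht) (by positivity))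

lemma coneJ_sub {h k : ℝ → ℝ → ℝ} (hm : Measurable (Function.uncurry h)) (hb : LB h)
    (km : Measurable (Function.uncurry k)) (kb : LB k) {x t : ℝ} (ht : 0 ≤ t) :
    coneJ h x t - coneJ k x t = coneJ (fun y s => h y s - k y s) x t := by
  rw [coneJ_eq h ht le_rfl, coneJ_eq k ht le_rfl, coneJ_eq _ ht le_rfl,
    ← intervalIntegral.integral_sub (coneI_intble hm hb _ _ _ _) (coneI_intble km kb _ _ _ _)]
  congr 1
  ext s
  rw [coneI, coneI, coneI,
    intervalIntegral.integral_sub (slice_intble hm hb _ _ _) (slice_intble km kb _ _ _)]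

lemma coneJ_congr {h k : ℝ → ℝ → ℝ} {x t : ℝ} (ht : 0 ≤ t)
    (hk : ∀ y s, 0 ≤ s → h y s = k y s) : coneJ h x t = coneJ k x t := by
  refine intervalIntegral.integral_congr fun s hs => ?_
  rw [uIcc_of_le ht] at hs
  simp only [hk _ s hs.1]

section main

variable {f : ℝ → ℝ} {L : NNReal} {g : ℝ → ℝ → ℝ} {B : ℝ}

lemma src_meas (hfc : Continuous f) (hgm : Measurable (Function.uncurry g)) {W : ℝ → ℝ → ℝ}
    (hW : Continuous (Function.uncurry W)) :
    Measurable (Function.uncurry fun y s => f (g y s + W y s)) :=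
  hfc.measurable.comp (hgm.add hW.measurable)

lemma src_bd (hfL : LipschitzWith L f) (hf0 : f 0 = 0) (hgB : ∀ y s : ℝ, |g y s| ≤ B)
    (W : ℝ → ℝ → ℝ) (y s : ℝ) : |f (g y s + W y s)| ≤ L * (B + |W y s|) := by
  have := hfL.dist_le_mul (g y s + W y s) 0
  rw [hf0, dist_zero_right, dist_zero_right] at this
  refine this.trans (mul_le_mul_of_nonneg_left ?_ L.2)
  exact (abs_add_le _ _).trans (by linarith [hgB y s])

lemma cont_LB {W : ℝ → ℝ → ℝ} (hW : Continuous (Function.uncurry W)) : LB W := by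
  intro R
  have hK : IsCompact (Icc (-R) R ×ˢ Icc (-R) R) := isCompact_Icc.prod isCompact_Icc
  obtain ⟨C, hC⟩ := hK.exists_bound_of_continuousOn hW.continuousOn
  exact ⟨C, fun y s hy hs => hC (y, s) ⟨abs_le.1 hy, abs_le.1 hs⟩⟩

lemma src_LB (hfL : LipschitzWith L f) (hf0 : f 0 = 0) (hgB : ∀ y s : ℝ, |g y s| ≤ B)
    {W : ℝ → ℝ → ℝ} (hW : Continuous (Function.uncurry W)) :
    LB fun y s => f (g y s + W y s) := by
  intro R
  obtain ⟨C, hC⟩ := cont_LB hW R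
  refine ⟨L * (B + C), fun y s hy hs => (src_bd hfL hf0 hgB W y s).trans ?_⟩
  exact mul_le_mul_of_nonneg_left (by linarith [hC y s hy hs]) L.2

lemma op_diff (hfc : Continuous f) (hfL : LipschitzWith L f) (hf0 : f 0 = 0)
    (hgm : Measurable (Function.uncurry g)) (hgB : ∀ y s : ℝ, |g y s| ≤ B)
    {V W : ℝ → ℝ → ℝ} (hV : Continuous (Function.uncurry V))
    (hW : Continuous (Function.uncurry W)) {C x t : ℝ} (hC0 : 0 ≤ C) (ht : 0 ≤ t)
    (hC : ∀ y s, 0 ≤ s → |y - x| + s ≤ t → |V y s - W y s| ≤ C * exp ((2 * L + 1) * s)) :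
    |(1/2) * coneJ (fun y s => f (g y s + V y s)) x t
      - (1/2) * coneJ (fun y s => f (g y s + W y s)) x t|
      ≤ C / 2 * exp ((2 * L + 1) * t) := by
  have hL : (0:ℝ) ≤ L := L.2
  rw [← mul_sub, coneJ_sub (src_meas hfc hgm hV) (src_LB hfL hf0 hgB hV)
    (src_meas hfc hgm hW) (src_LB hfL hf0 hgB hW) ht, abs_mul]
  have h1 := coneJ_bound (h := fun y s => f (g y s + V y s) - f (g y s + W y s))
    (l := 2 * L + 1) (C := L * C) (x := x) (t := t) (by linarith) ht (by positivity) (by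
      intro y s hs hy
      have := hfL.dist_le_mul (g y s + V y s) (g y s + W y s)
      rw [Real.dist_eq, Real.dist_eq, add_sub_add_left_eq_sub] at this
      refine this.trans ?_
      rw [mul_assoc]
      exact mul_le_mul_of_nonneg_left (hC y s hs hy) hL)
  have h2 : |(1/2:ℝ)| = 1/2 := abs_of_pos (by norm_num)
  rw [h2]
  have h3 : (L:ℝ) / (2 * L + 1) ^ 2 ≤ 1 / 2 := by
    rw [div_le_div_iff₀ (by positivity) (by norm_num)]
    nlinarith
  calc _ ≤ 1/2 * (2 * (L * C) * (exp ((2 * L + 1) * t) / (2 * L + 1) ^ 2)) :=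
        mul_le_mul_of_nonneg_left h1 (by norm_num)
    _ = (L / (2 * L + 1) ^ 2) * (C * exp ((2 * L + 1) * t)) := by ring
    _ ≤ 1 / 2 * (C * exp ((2 * L + 1) * t)) :=
        mul_le_mul_of_nonneg_right h3 (by positivity)
    _ = _ := by ring

lemma op_bound (hfL : LipschitzWith L f) (hf0 : f 0 = 0)
    (hgB : ∀ y s : ℝ, |g y s| ≤ B)
    {W : ℝ → ℝ → ℝ} {C x t : ℝ} (hC0 : 0 ≤ C) (ht : 0 ≤ t)
    (hC : ∀ y s, 0 ≤ s → |W y s| ≤ C * exp ((2 * L + 1) * s)) :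
    |(1/2) * coneJ (fun y s => f (g y s + W y s)) x t|
      ≤ L * (B + C) * exp ((2 * L + 1) * t) := by
  have hL : (0:ℝ) ≤ L := L.2
  have hB : 0 ≤ B := (abs_nonneg _).trans (hgB 0 0)
  have h1 := coneJ_bound (h := fun y s => f (g y s + W y s))
    (l := 2 * L + 1) (C := L * (B + C)) (x := x) (t := t) (by linarith) ht (by positivity) (by
      intro y s hs hy
      refine (src_bd hfL hf0 hgB W y s).trans ?_
      rw [mul_assoc]
      refine mul_le_mul_of_nonneg_left ?_ hL
      have h1 : 1 ≤ exp ((2 * L + 1) * s) := one_le_exp (by positivity)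
      nlinarith [hC y s hs])
  rw [abs_mul, abs_of_pos (by norm_num : (0:ℝ) < 1/2)]
  have h3 : 1 / (2 * (L:ℝ) + 1) ^ 2 ≤ 1 := by
    rw [div_le_one (by positivity)]
    nlinarith
  calc _ ≤ 1/2 * (2 * (L * (B + C)) * (exp ((2 * L + 1) * t) / (2 * L + 1) ^ 2)) :=
        mul_le_mul_of_nonneg_left h1 (by norm_num)
    _ = (1 / (2 * L + 1) ^ 2) * (L * (B + C) * exp ((2 * L + 1) * t)) := by ring
    _ ≤ 1 * (L * (B + C) * exp ((2 * L + 1) * t)) :=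
        mul_le_mul_of_nonneg_right h3 (by positivity)
    _ = _ := by ring

lemma sol_unique (hfc : Continuous f) (hfL : LipschitzWith L f) (hf0 : f 0 = 0)
    (hgm : Measurable (Function.uncurry g)) (hgB : ∀ y s : ℝ, |g y s| ≤ B)
    {V W : ℝ → ℝ → ℝ} (hV : Continuous (Function.uncurry V))
    (hW : Continuous (Function.uncurry W))
    (eV : ∀ x t, 0 ≤ t → V x t = (1/2) * coneJ (fun y s => f (g y s + V y s)) x t)
    (eW : ∀ x t, 0 ≤ t → W x t = (1/2) * coneJ (fun y s => f (g y s + W y s)) x t)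
    (x₀ t₀ : ℝ) (ht₀ : 0 ≤ t₀) : V x₀ t₀ = W x₀ t₀ := by
  have hL : (0:ℝ) ≤ L := L.2
  obtain ⟨C, hC⟩ := cont_LB (W := fun x t => V x t - W x t) (hV.sub hW) (|x₀| + t₀)
  have key : ∀ n : ℕ, ∀ x t, 0 ≤ t → |x - x₀| + t ≤ t₀ →
      |V x t - W x t| ≤ |C| * (1/2) ^ n * exp ((2 * L + 1) * t) := by
    intro n
    induction n with
    | zero =>
      intro x t ht hx
      have h1 : 1 ≤ exp ((2 * L + 1) * t) := one_le_exp (by positivity)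
      have h2 : |V x t - W x t| ≤ C := by
        refine hC x t ?_ ?_
        · have := abs_add_le (x - x₀) x₀
          rw [sub_add_cancel] at this
          linarith
        · rw [abs_of_nonneg ht]
          linarith [abs_nonneg x₀, abs_nonneg (x - x₀)]
      have h3 := le_abs_self C
      have h4 := abs_nonneg C
      simp only [pow_zero, mul_one]
      nlinarith
    | succ n ih =>
      intro x t ht hx
      rw [eV x t ht, eW x t ht]
      refine (op_diff hfc hfL hf0 hgm hgB hV hW (C := |C| * (1/2) ^ n) (by positivity) ht
        fun y s hs hy => ih y s hs ?_).trans (le_of_eq (by ring))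
      have := abs_sub_le y x x₀
      linarith
  have hlim : Tendsto (fun n : ℕ => |C| * (1/2) ^ n * exp ((2 * L + 1) * t₀)) atTop (𝓝 0) := by
    have := ((tendsto_pow_atTop_nhds_zero_of_lt_one (r := (1/2:ℝ)) (by norm_num)
      (by norm_num)).const_mul |C|).mul_const (exp ((2 * L + 1) * t₀))
    simpa using this
  have h0 := ge_of_tendsto' hlim fun n => key n x₀ t₀ ht₀ (by simp)
  exact sub_eq_zero.1 (abs_eq_zero.1 (le_antisymm h0 (abs_nonneg _)))

lemma sol_exists (hfc : Continuous f) (hfL : LipschitzWith L f) (hf0 : f 0 = 0)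
    (hgm : Measurable (Function.uncurry g)) (hgB : ∀ y s : ℝ, |g y s| ≤ B) :
    ∃ W : ℝ → ℝ → ℝ, Continuous (Function.uncurry W) ∧
      ∀ x t, 0 ≤ t → W x t = (1/2) * coneJ (fun y s => f (g y s + W y s)) x t := by
  have hL : (0:ℝ) ≤ L := L.2
  have hB : 0 ≤ B := (abs_nonneg _).trans (hgB 0 0)
  let Wt : BoundedContinuousFunction (ℝ × ℝ) ℝ → ℝ → ℝ → ℝ :=
    fun u y s => exp ((2 * L + 1) * s) * u (y, s)
  have hWt : ∀ u, Continuous (Function.uncurry (Wt u)) := by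
    intro u
    change Continuous fun p : ℝ × ℝ => exp ((2 * L + 1) * p.2) * u (p.1, p.2)
    have := u.continuous
    fun_prop
  let F : BoundedContinuousFunction (ℝ × ℝ) ℝ → ℝ × ℝ → ℝ := fun u p =>
    exp (-((2 * L + 1) * max p.2 0)) *
      ((1/2) * coneJ (fun y s => f (g y s + Wt u y s)) p.1 (max p.2 0))
  have hFc : ∀ u, Continuous (F u) := by
    intro u
    have h1 := coneJ_cont (src_meas hfc hgm (hWt u)) (src_LB hfL hf0 hgB (hWt u))
    exact (by fun_prop : Continuous fun p : ℝ × ℝ => exp (-((2 * L + 1) * max p.2 0))).mul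
      (continuous_const.mul h1)
  have hexp : ∀ c t A D : ℝ, |A| ≤ D * exp (c * t) → |exp (-(c * t)) * A| ≤ D := by
    intro c t A D h
    rw [abs_mul, abs_of_pos (exp_pos _)]
    calc _ ≤ exp (-(c * t)) * (D * exp (c * t)) := mul_le_mul_of_nonneg_left h (exp_pos _).le
      _ = D * (exp (-(c * t)) * exp (c * t)) := by ring
      _ = D := by rw [← exp_add]; simp
  have hFb : ∀ u p, ‖F u p‖ ≤ L * (B + ‖u‖) := by
    intro u p
    refine hexp _ _ _ _ (op_bound hfL hf0 hgB (norm_nonneg u) (le_max_right _ _) ?_)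
    intro y s _
    change |exp ((2 * L + 1) * s) * u (y, s)| ≤ _
    rw [abs_mul, abs_of_pos (exp_pos _), mul_comm]
    exact mul_le_mul_of_nonneg_right (u.norm_coe_le_norm (y, s)) (exp_pos _).le
  let Φ : BoundedContinuousFunction (ℝ × ℝ) ℝ → BoundedContinuousFunction (ℝ × ℝ) ℝ :=
    fun u => BoundedContinuousFunction.ofNormedAddCommGroup (F u) (hFc u) _ (hFb u)
  have hΦ : ContractingWith (1/2) Φ := by
    refine ⟨by
      rw [← NNReal.coe_lt_coe]; norm_num, LipschitzWith.of_dist_le_mul fun u v => ?_⟩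
    rw [BoundedContinuousFunction.dist_le (by positivity)]
    intro p
    change dist (F u p) (F v p) ≤ _
    rw [Real.dist_eq]
    simp only [F]
    rw [← mul_sub]
    have := op_diff hfc hfL hf0 hgm hgB (hWt u) (hWt v) (C := dist u v) (x := p.1)
      (t := max p.2 0) dist_nonneg (le_max_right _ _) (by
        intro y s _ _
        change |exp ((2 * L + 1) * s) * u (y, s) - exp ((2 * L + 1) * s) * v (y, s)| ≤ _
        rw [← mul_sub, abs_mul, abs_of_pos (exp_pos _), mul_comm]
        have hd : dist (u (y, s)) (v (y, s)) ≤ dist u v :=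
          BoundedContinuousFunction.dist_coe_le_dist (y, s)
        rw [Real.dist_eq] at hd
        exact mul_le_mul_of_nonneg_right hd (exp_pos _).le)
    refine (hexp _ _ _ _ this).trans (le_of_eq ?_)
    push_cast
    ring
  have hfix := hΦ.fixedPoint_isFixedPt
  set u := ContractingWith.fixedPoint Φ hΦ
  refine ⟨Wt u, hWt u, fun x t ht => ?_⟩
  have h1 : u (x, t) = F u (x, t) := by
    conv_lhs => rw [← hfix]
    rfl
  change exp ((2 * L + 1) * t) * u (x, t) = _
  rw [h1]
  simp only [F]
  rw [max_eq_left ht, ← mul_assoc, ← exp_add]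
  simp

end main

/-- Existence and uniqueness of the continuous solution, with zero initial data,
of the integral equation corresponding to `∂_t²w - ∂_x²w = f(g + w)` on the
upper half-plane, for continuous globally Lipschitz `f` with `f(0) = 0` and
measurable bounded `g`. -/
theorem continuous_solution_exists_unique
    (f : ℝ → ℝ) (hfc : Continuous f) (L : NNReal) (hfL : LipschitzWith L f)
    (hf0 : f 0 = 0)
    (g : ℝ → ℝ → ℝ) (hgm : Measurable (Function.uncurry g))
    (B : ℝ) (hgB : ∀ y s : ℝ, |g y s| ≤ B) :
    ∃ w : ℝ → ℝ → ℝ,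
      (ContinuousOn (fun p : ℝ × ℝ => w p.1 p.2) {p : ℝ × ℝ | 0 ≤ p.2} ∧
        ∀ x t : ℝ, 0 ≤ t →
          w x t = (1/2) * ∫ s in (0:ℝ)..t, ∫ y in (x - t + s)..(x + t - s),
            f (g y s + w y s)) ∧
      ∀ w' : ℝ → ℝ → ℝ,
        (ContinuousOn (fun p : ℝ × ℝ => w' p.1 p.2) {p : ℝ × ℝ | 0 ≤ p.2} ∧
          ∀ x t : ℝ, 0 ≤ t →
            w' x t = (1/2) * ∫ s in (0:ℝ)..t, ∫ y in (x - t + s)..(x + t - s),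
              f (g y s + w' y s)) →
        ∀ x t : ℝ, 0 ≤ t → w' x t = w x t := by
  obtain ⟨W, hW, eW⟩ := sol_exists hfc hfL hf0 hgm hgB
  refine ⟨W, ⟨hW.continuousOn, eW⟩, ?_⟩
  rintro w' ⟨hc, he⟩ x t ht
  have hV : Continuous (Function.uncurry fun x t => w' x (max t 0)) := by
    have := hc.comp_continuous (f := fun p : ℝ × ℝ => (p.1, max p.2 0)) (by fun_prop)
      (fun p => le_max_right p.2 0)
    exact this
  have := sol_unique hfc hfL hf0 hgm hgB hV hW (fun x t ht => by
    simp only [max_eq_left ht]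
    rw [he x t ht]
    congr 1
    refine coneJ_congr (h := fun y s => f (g y s + w' y s)) ht fun y s hs => ?_
    simp only [max_eq_left hs]) eW x t ht
  simpa only [max_eq_left ht] using this
end
end
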